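/- arXiv:0809.4966 — 3 statements merged into one kernel-verified Lean document; each statement's English description precedes it below -/
import Mathlib

section
/- Let R = ℤ[a_1,…,a_d] be a polynomial ring over ℤ, graded by assigning to each variable a_i a positive degree deg a_i. Let I ⊆ R be an ideal generated by homogeneous elements b_1,…,b_d (as many generators as variables), and let φ : R/I → H be a surjective ring homomorphism onto a commutative ring H. Assume: (i) H is a free ℤ-module of rank ∏_{i=1}^{d} (deg b_i / deg a_i), and (ii) for every field K the K-vector space (R/I) ⊗_ℤ K is finite dimensional. Then φ is an isomorphism. -/
open MvPolynomial

/-- Contraction map. -/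
noncomputable def contr (K : Type) [Field K] (d q : ℕ) [NeZero q] :
    MvPolynomial (Fin d) K →ₗ[K] ((Fin d → Fin q) → MvPolynomial (Fin d) K) :=
  (basisMonomials (Fin d) K).constr K fun β =>
    Pi.single (fun j => Fin.ofNat q (β j)) (monomial (β.mapRange (· / q) (by simp)) 1)

theorem contr_monomial (K : Type) [Field K] (d q : ℕ) [NeZero q] (β : Fin d →₀ ℕ) :
    contr K d q (monomial β 1) =
    Pi.single (fun j => Fin.ofNat q (β j)) (monomial (β.mapRange (· / q) (by simp)) 1) := by
  have := (basisMonomials (Fin d) K).constr_basis K (fun β =>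
    (Pi.single (fun j => Fin.ofNat q (β j)) (monomial (β.mapRange (· / q) (by simp)) (1:K)) :
      (Fin d → Fin q) → MvPolynomial (Fin d) K)) β
  simpa [contr] using this

theorem contr_expand_mul (K : Type) [Field K] (d q : ℕ) [NeZero q]
    (g f : MvPolynomial (Fin d) K) :
    contr K d q (expand q g * f) = g • contr K d q f := by
  have hq : 0 < q := Nat.pos_of_ne_zero (NeZero.ne q)
  induction g using MvPolynomial.induction_on' with
  | add a b ha hb => simp [add_mul, ha, hb, add_smul]
  | monomial α c =>
    induction f using MvPolynomial.induction_on' with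
    | add a b ha hb => rw [mul_add, map_add, ha, hb, map_add, smul_add]
    | monomial β e =>
      have h1 : expand q (monomial α c) * monomial β e
          = (c * e) • monomial (q • α + β) (1 : K) := by
        rw [expand_monomial, monomial_mul, smul_monomial]; simp
      have h2 : (monomial β e : MvPolynomial (Fin d) K) = e • monomial β 1 := by
        rw [smul_monomial]; simp
      rw [h1, h2, map_smul, map_smul, contr_monomial, contr_monomial]
      have e1 : (fun j => Fin.ofNat q ((q • α + β) j)) = fun j => Fin.ofNat q (β j) := by
        funext j; ext; simp
      have e2 : (q • α + β).mapRange (· / q) (by simp) = α + β.mapRange (· / q) (by simp) := by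
        ext j; simp [Nat.mul_add_div hq]
      rw [e1, e2]
      funext r
      simp only [Pi.smul_apply, Pi.single_apply]
      split_ifs
      · simp [smul_monomial, monomial_mul]
      · simp

theorem contr_surj (K : Type) [Field K] (d q : ℕ) [NeZero q] :
    Function.Surjective (contr K d q) := by
  have hq : 0 < q := Nat.pos_of_ne_zero (NeZero.ne q)
  intro F
  have key : ∀ (r : Fin d → Fin q) (g : MvPolynomial (Fin d) K),
      ∃ f, contr K d q f = Pi.single r g := by
    intro r g
    refine ⟨expand q g * monomial (Finsupp.equivFunOnFinite.symm fun j => (r j : ℕ)) 1, ?_⟩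
    rw [contr_expand_mul, contr_monomial]
    have e1 : (fun j => Fin.ofNat q ((Finsupp.equivFunOnFinite.symm fun j => (r j : ℕ)) j)) = r := by
      funext j; ext; simp 
    have e2 : (Finsupp.equivFunOnFinite.symm fun j => (r j : ℕ)).mapRange (· / q) (by simp) 
        = (0 : Fin d →₀ ℕ) := by
      ext j; simp
    rw [e1, e2]
    funext s
    by_cases h : s = r
    · subst h; simp
    · simp [h]
  choose G hG using key
  refine ⟨∑ r, G r (F r), ?_⟩
  simp [map_sum, hG, Finset.univ_sum_single]

theorem expand_pow_zmod (p : ℕ) [Fact p.Prime] (d k : ℕ) (f : MvPolynomial (Fin d) (ZMod p)) :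
    expand (p ^ k) f = f ^ (p ^ k) := by
  induction k with
  | zero => simp
  | succ k ih => rw [pow_succ, mul_comm, expand_mul, ih, map_pow, expand_zmod, ← pow_mul]

/-- Lower bound for the dimension of the Frobenius power quotient. -/
theorem finrank_lower (p : ℕ) [Fact p.Prime] (d k : ℕ)
    (b : Fin d → MvPolynomial (Fin d) (ZMod p))
    [Module.Finite (ZMod p) (MvPolynomial (Fin d) (ZMod p) ⧸ Ideal.span (Set.range b))]
    [Module.Finite (ZMod p) (MvPolynomial (Fin d) (ZMod p) ⧸
      Ideal.span (Set.range fun j => b j ^ (p ^ k)))] :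
    (p ^ k) ^ d * Module.finrank (ZMod p)
      (MvPolynomial (Fin d) (ZMod p) ⧸ Ideal.span (Set.range b)) ≤
    Module.finrank (ZMod p) (MvPolynomial (Fin d) (ZMod p) ⧸
      Ideal.span (Set.range fun j => b j ^ (p ^ k))) := by
  set q := p ^ k with hqdef
  have hp := (Fact.out : p.Prime).pos
  have : NeZero q := ⟨by positivity⟩
  set I := Ideal.span (Set.range b) with hI
  set J := Ideal.span (Set.range fun j => b j ^ q) with hJ
  let π : ((Fin d → Fin q) → MvPolynomial (Fin d) (ZMod p)) →ₗ[ZMod p]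
      ((Fin d → Fin q) → MvPolynomial (Fin d) (ZMod p) ⧸ I) :=
    LinearMap.pi fun r => (Ideal.Quotient.mkₐ (ZMod p) I).toLinearMap ∘ₗ LinearMap.proj r
  have hπ : Function.Surjective π := by
    intro F
    choose G hG using fun r => Ideal.Quotient.mk_surjective (F r)
    exact ⟨G, funext fun r => hG r⟩
  let L := π ∘ₗ contr (ZMod p) d q
  have hL : Function.Surjective L := hπ.comp (contr_surj _ _ _)
  have hker : J.restrictScalars (ZMod p) ≤ LinearMap.ker L := by
    intro x hx
    rw [Submodule.restrictScalars_mem, hJ, Ideal.mem_span_range_iff_exists_fun] at hx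
    obtain ⟨c, rfl⟩ := hx
    rw [LinearMap.mem_ker, map_sum]
    refine Finset.sum_eq_zero fun j _ => ?_
    funext r
    have : L (c j * b j ^ q) r = Ideal.Quotient.mk I (contr (ZMod p) d q (c j * b j ^ q) r) := rfl
    have hx : b j ^ q = expand q (b j) := (expand_pow_zmod p d k (b j)).symm
    rw [this, mul_comm, hx, contr_expand_mul]
    rw [Pi.zero_apply, Ideal.Quotient.eq_zero_iff_mem]
    exact I.mul_mem_right _ (Ideal.subset_span ⟨j, rfl⟩)
  let L' : (MvPolynomial (Fin d) (ZMod p) ⧸ J) →ₗ[ZMod p] _ :=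
    (J.restrictScalars (ZMod p)).liftQ L hker
  have hL' : Function.Surjective L' := by
    intro F
    obtain ⟨f, hf⟩ := hL F
    exact ⟨Ideal.Quotient.mk J f, hf⟩
  have := LinearMap.finrank_le_finrank_of_surjective hL'
  simpa [Module.finrank_pi_fintype] using this

/-- The standard elements span the Frobenius power quotient. -/
theorem span_top {K : Type} [Field K] (d q D : ℕ) [NeZero q]
    (b : Fin d → MvPolynomial (Fin d) K) (e : Fin D → MvPolynomial (Fin d) K)
    (he : ∀ f, ∃ s ∈ Submodule.span K (Set.range e), f - s ∈ Ideal.span (Set.range b)) :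
    (⊤ : Submodule K (MvPolynomial (Fin d) K ⧸ Ideal.span (Set.range fun j => b j ^ q))) ≤
      Submodule.span K (Set.range fun x : Fin D × (Fin d → Fin q) =>
        (Ideal.Quotient.mk (Ideal.span (Set.range fun j => b j ^ q))
          (e x.1 * ∏ j, b j ^ (x.2 j : ℕ)))) := by
  set I := Ideal.span (Set.range b) with hI
  set J := Ideal.span (Set.range fun j => b j ^ q) with hJ
  set S : Submodule K (MvPolynomial (Fin d) K) :=
    Submodule.span K (Set.range fun x : Fin D × (Fin d → ℕ) => e x.1 * ∏ j, b j ^ (x.2 j)) with hS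
  have hSb : ∀ j, ∀ s ∈ S, s * b j ∈ S := by
    intro j s hs
    induction hs using Submodule.span_induction with
    | mem x hx =>
      obtain ⟨⟨i, α⟩, rfl⟩ := hx
      refine Submodule.subset_span ⟨⟨i, α + Pi.single j 1⟩, ?_⟩
      have h1 : ∏ x, b x ^ ((Pi.single j 1 : Fin d → ℕ) x) = b j := by
        rw [Finset.prod_eq_single j] <;> simp +contextual
      simp only [Pi.add_apply, pow_add, Finset.prod_mul_distrib, h1, mul_assoc]
    | zero => simp
    | add x y _ _ hx hy => rw [add_mul]; exact S.add_mem hx hy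
    | smul a x _ hx => rw [smul_mul_assoc]; exact S.smul_mem _ hx
  have heS : Submodule.span K (Set.range e) ≤ S := by
    rw [Submodule.span_le]
    rintro _ ⟨i, rfl⟩
    exact Submodule.subset_span ⟨⟨i, 0⟩, by simp⟩
  have hN : ∀ N : ℕ, ∀ f, ∃ s ∈ S, f - s ∈ I ^ N := by
    intro N
    induction N with
    | zero => intro f; exact ⟨0, S.zero_mem, by simp⟩
    | succ N ih =>
      intro f
      obtain ⟨s, hs, hfs⟩ := he f
      rw [hI, Ideal.mem_span_range_iff_exists_fun] at hfs
      obtain ⟨c, hc⟩ := hfs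
      choose t ht htc using fun j => ih (c j)
      refine ⟨s + ∑ j, t j * b j, S.add_mem (heS hs) (S.sum_mem fun j _ => hSb j _ (ht j)), ?_⟩
      rw [← sub_sub, ← hc, ← Finset.sum_sub_distrib]
      refine Ideal.sum_mem _ fun j _ => ?_
      rw [← sub_mul, pow_succ]
      exact Ideal.mul_mem_mul (htc j) (Ideal.subset_span ⟨j, rfl⟩)
  have hnil : ∃ N, I ^ N ≤ J := by
    have : IsNilpotent (I.map (Ideal.Quotient.mk J)) := by
      rw [Ideal.FG.isNilpotent_iff_le_nilradical]
      · rw [hI, Ideal.map_span, Ideal.span_le]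
        rintro _ ⟨_, ⟨j, rfl⟩, rfl⟩
        refine ⟨q, ?_⟩
        rw [← map_pow]
        refine Ideal.Quotient.eq_zero_iff_mem.2 ?_
        exact Ideal.subset_span ⟨j, rfl⟩
      · exact (isNoetherianRing_iff_ideal_fg _).1 inferInstance _
    obtain ⟨N, hN⟩ := this
    refine ⟨N, ?_⟩
    rw [← Ideal.map_pow] at hN
    have := (Ideal.map_eq_bot_iff_le_ker _).1 hN
    rwa [Ideal.mk_ker] at this
  obtain ⟨N, hNJ⟩ := hnil
  rintro x -
  obtain ⟨f, rfl⟩ := Ideal.Quotient.mk_surjective x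
  obtain ⟨s, hs, hfs⟩ := hN N f
  have : Ideal.Quotient.mk J f = Ideal.Quotient.mk J s := Ideal.Quotient.eq.2 (hNJ hfs)
  rw [this]
  clear this hfs
  induction hs using Submodule.span_induction with
  | mem x hx =>
    obtain ⟨⟨i, α⟩, rfl⟩ := hx
    by_cases hα : ∀ j, α j < q
    · exact Submodule.subset_span ⟨⟨i, fun j => ⟨α j, hα j⟩⟩, rfl⟩
    · push Not at hα
      obtain ⟨j, hj⟩ := hα
      have : Ideal.Quotient.mk J (e i * ∏ j, b j ^ α j) = 0 := by
        rw [Ideal.Quotient.eq_zero_iff_mem]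
        refine J.mul_mem_left _ ?_
        refine J.mem_of_dvd ((pow_dvd_pow (b j) hj).trans
          (Finset.dvd_prod_of_mem (fun j => b j ^ α j) (Finset.mem_univ j)))
          (Ideal.subset_span ⟨j, rfl⟩)
      simp only [this]
      exact Submodule.zero_mem _
  | zero => simp
  | add x y _ _ hx hy => rw [map_add]; exact Submodule.add_mem _ hx hy
  | smul a x _ hx => 
    have : Ideal.Quotient.mk J (a • x) = a • Ideal.Quotient.mk J x := rfl
    rw [this]; exact Submodule.smul_mem _ _ hx

instance jacobson_int : IsJacobsonRing ℤ := by
  rw [isJacobsonRing_iff_prime_eq]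
  intro P hP
  by_cases h : P = ⊥
  · subst h
    rw [eq_bot_iff]
    intro n hn
    rw [Ideal.mem_jacobson_bot] at hn
    by_contra h0
    have h0 : n ≠ 0 := h0
    have h1 := hn (n * 1)
    have h2 := hn (n * 2)
    rw [Int.isUnit_iff] at h1 h2
    have : 0 < n * n := mul_self_pos.2 h0
    rcases h1 with h1 | h1 <;> nlinarith
  · exact Ideal.jacobson_eq_self_of_isMaximal (H := hP.isMaximal h)

/-- A maximal ideal in a finite type `ℤ`-algebra contains a prime number. -/
theorem exists_prime_mem (S : Type) [CommRing S] [Algebra.FiniteType ℤ S] (m : Ideal S)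
    [hm : m.IsMaximal] : ∃ p : ℕ, p.Prime ∧ (p : S) ∈ m := by
  let := Ideal.Quotient.field m
  have hf : Module.Finite ℤ (S ⧸ m) := finite_of_finite_type_of_isJacobsonRing ℤ (S ⧸ m)
  obtain ⟨p, hp⟩ := CharP.exists (S ⧸ m)
  rcases CharP.char_is_prime_or_zero (S ⧸ m) p with h | h
  · refine ⟨p, h, ?_⟩
    rw [← Ideal.Quotient.eq_zero_iff_mem, map_natCast]
    exact CharP.cast_eq_zero _ _
  · subst h
    have := CharP.charP_to_charZero (S ⧸ m)
    exact absurd (isField_of_isIntegral_of_isField (R := ℤ) (S := S ⧸ m)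
      (algebraMap ℤ (S ⧸ m)).injective_int (Field.toIsField _)) Int.not_isField

theorem eq_bot_of_divisible (S : Type) [CommRing S] [Algebra.FiniteType ℤ S] (N : Ideal S)
    (h : ∀ p : ℕ, p.Prime → ∀ x ∈ N, ∃ y ∈ N, x = p * y) : N = ⊥ := by
  have : IsNoetherianRing S := Algebra.FiniteType.isNoetherianRing ℤ S
  by_contra hN
  have hann : Module.annihilator S N ≠ ⊤ := by
    intro ht
    apply hN
    rw [eq_bot_iff]
    intro x hx
    have h1 : (1 : S) ∈ Module.annihilator S N := by rw [ht]; trivial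
    rw [Module.mem_annihilator] at h1
    simpa using congrArg Subtype.val (h1 ⟨x, hx⟩)
  obtain ⟨m, hm, hle⟩ := Ideal.exists_le_maximal _ hann
  obtain ⟨p, hp, hpm⟩ := exists_prime_mem S m
  obtain ⟨r, hr, hr0⟩ := Submodule.exists_sub_one_mem_and_smul_eq_zero_of_fg_of_le_smul
    (Ideal.span {(p : S)}) N ((isNoetherianRing_iff_ideal_fg _).1 inferInstance _) (by
      intro x hx
      obtain ⟨y, hy, rfl⟩ := h p hp x hx
      exact Submodule.smul_mem_smul (Ideal.mem_span_singleton_self _) hy)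
  have h1 : r ∈ m := hle (by
    rw [Module.mem_annihilator]
    intro n
    exact Subtype.ext (hr0 n n.2))
  have h2 : r - 1 ∈ m := (Ideal.span_le.2 (by simpa using hpm) : Ideal.span {(p:S)} ≤ m) hr
  apply hm.ne_top
  rw [Ideal.eq_top_iff_one]
  have := m.sub_mem h1 h2
  simpa using this

/-- Lattice points of a weighted simplex. -/
def simplexPts (d : ℕ) (w : Fin d → ℕ) (n : ℕ) : Finset (Fin d → ℕ) :=
  (Fintype.piFinset fun _ => Finset.range (n + 1)).filter fun β => ∑ j, β j * w j ≤ n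

theorem mem_simplexPts {d : ℕ} {w : Fin d → ℕ} (hw : ∀ i, 0 < w i) {n : ℕ} {β : Fin d → ℕ} :
    β ∈ simplexPts d w n ↔ ∑ j, β j * w j ≤ n := by
  simp only [simplexPts, Finset.mem_filter, Fintype.mem_piFinset, Finset.mem_range,
    and_iff_right_iff_imp]
  intro h j
  have h1 : β j * w j ≤ ∑ j, β j * w j :=
    Finset.single_le_sum (f := fun j => β j * w j) (fun _ _ => Nat.zero_le _) (Finset.mem_univ j)
  have := Nat.le_mul_of_pos_right (β j) (hw j)
  omega

theorem simplex_le (d : ℕ) (w : Fin d → ℕ) (hw : ∀ i, 0 < w i) (n : ℕ) :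
    (simplexPts d (fun _ => 1) n).card ≤ (∏ i, w i) * (simplexPts d w n).card := by
  have : (∏ i, w i) = (Fintype.piFinset fun i => Finset.range (w i)).card := by
    simp [Fintype.card_piFinset]
  rw [this, ← Finset.card_product]
  refine Finset.card_le_card_of_injOn (fun γ => (fun j => γ j % w j, fun j => γ j / w j)) ?_ ?_
  · intro γ hγ
    have hγ := (mem_simplexPts (by simp)).1 hγ
    simp only [Finset.coe_product, Set.mem_prod, Finset.mem_coe, Fintype.mem_piFinset,
      Finset.mem_range, mem_simplexPts hw]
    refine ⟨fun j => Nat.mod_lt _ (hw j), le_trans (Finset.sum_le_sum fun j _ => ?_) hγ⟩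
    simpa using Nat.div_mul_le_self _ _
  · intro γ _ γ' _ h
    simp only [Prod.mk.injEq] at h
    funext j
    have h1 := congrFun h.1 j
    have h2 := congrFun h.2 j
    rw [← Nat.div_add_mod (γ j) (w j), ← Nat.div_add_mod (γ' j) (w j), h1, h2]

theorem le_simplex (d : ℕ) (w : Fin d → ℕ) (hw : ∀ i, 0 < w i) (n : ℕ) :
    (∏ i, w i) * (simplexPts d w n).card ≤ (simplexPts d (fun _ => 1) (n + ∑ i, w i)).card := by
  have : (∏ i, w i) = (Fintype.piFinset fun i => Finset.range (w i)).card := by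
    simp [Fintype.card_piFinset]
  rw [this, ← Finset.card_product]
  refine Finset.card_le_card_of_injOn (fun x => fun j => x.2 j * w j + x.1 j) ?_ ?_
  · rintro ⟨r, β⟩ hx
    simp only [Finset.coe_product, Set.mem_prod, Finset.mem_coe, Fintype.mem_piFinset,
      Finset.mem_range, mem_simplexPts hw] at hx
    refine (mem_simplexPts (by simp)).2 ?_
    simp only [mul_one, Finset.sum_add_distrib]
    exact add_le_add hx.2 (Finset.sum_le_sum fun j _ => (hx.1 j).le)
  · rintro ⟨r, β⟩ hx ⟨r', β'⟩ hx' h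
    simp only [Finset.coe_product, Set.mem_prod, Finset.mem_coe, Fintype.mem_piFinset,
      Finset.mem_range] at hx hx'
    have key : ∀ j, r j = r' j ∧ β j = β' j := by
      intro j
      have h1 := congrFun h j
      simp only at h1
      have a := congrArg (· % w j) h1
      have c := congrArg (· / w j) h1
      simp only [Nat.mul_add_mod_self_right, Nat.mod_eq_of_lt (hx.1 j),
        Nat.mod_eq_of_lt (hx'.1 j)] at a
      refine ⟨a, ?_⟩
      rw [a] at h1
      exact Nat.eq_of_mul_eq_mul_right (hw j) (by omega)
    ext j
    · exact (key j).1
    · exact (key j).2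

theorem simplex_card_le (d n : ℕ) (w : Fin d → ℕ) : (simplexPts d w n).card ≤ (n + 1) ^ d := by
  refine (Finset.card_filter_le _ _).trans ?_
  simp [Fintype.card_piFinset]

theorem growth (P P' C d : ℕ) (N : ℕ → ℕ) (h0 : 1 ≤ N 0) (hN : ∀ n, N n ≤ (n + 1) ^ d)
    (h : ∀ n, P' * N n ≤ P * N (n + C)) : P' ≤ P := by
  by_contra hlt
  push Not at hlt
  have hP : 0 < P := by
    rcases Nat.eq_zero_or_pos P with rfl | hP
    · have := h 0
      simp at this
      omega
    · exact hP
  have hk : ∀ k : ℕ, P' ^ k ≤ P ^ k * N (k * C) := by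
    intro k
    induction k with
    | zero => simpa using h0
    | succ k ih =>
      calc P' ^ (k + 1) = P' * P' ^ k := by ring
        _ ≤ P' * (P ^ k * N (k * C)) := Nat.mul_le_mul_left _ ih
        _ = P ^ k * (P' * N (k * C)) := by ring
        _ ≤ P ^ k * (P * N (k * C + C)) := Nat.mul_le_mul_left _ (h _)
        _ = P ^ (k + 1) * N ((k + 1) * C) := by rw [add_mul, one_mul]; ring
  have hr : (1 : ℝ) < P' / P := by
    rw [one_lt_div (by positivity)]; exact_mod_cast hlt
  have ht := (tendsto_pow_const_div_const_pow_of_one_lt d hr).const_mul ((2 * C + 1 : ℝ) ^ d)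
  rw [mul_zero] at ht
  obtain ⟨k, hk1, hk2⟩ := ((ht.eventually (gt_mem_nhds one_pos)).and
    (Filter.eventually_ge_atTop 1)).exists
  have h1 : (P' : ℝ) ^ k ≤ P ^ k * (k * C + 1) ^ d := by
    have := (hk k).trans (Nat.mul_le_mul_left _ (hN _))
    exact_mod_cast this
  have h2 : ((k : ℝ) * C + 1) ^ d ≤ ((2 * C + 1) ^ d) * k ^ d := by
    rw [← mul_pow]
    have : (1 : ℝ) ≤ k := by exact_mod_cast hk2
    gcongr
    have : (0:ℝ) ≤ C := by positivity
    nlinarith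
  rw [← mul_div_assoc, div_lt_one (by positivity), div_pow, lt_div_iff₀ (by positivity)] at hk1
  have : (0:ℝ) < (P:ℝ) ^ k := by positivity
  nlinarith

/-- Linear independence over the base field of the standard elements. -/
theorem indep (p : ℕ) [Fact p.Prime] (d k D : ℕ)
    (b : Fin d → MvPolynomial (Fin d) (ZMod p)) (e : Fin D → MvPolynomial (Fin d) (ZMod p))
    [Module.Finite (ZMod p) (MvPolynomial (Fin d) (ZMod p) ⧸ Ideal.span (Set.range b))]
    (hD : D = Module.finrank (ZMod p)
      (MvPolynomial (Fin d) (ZMod p) ⧸ Ideal.span (Set.range b)))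
    (he : ∀ f, ∃ s ∈ Submodule.span (ZMod p) (Set.range e), f - s ∈ Ideal.span (Set.range b)) :
    LinearIndependent (ZMod p) (fun x : Fin D × (Fin d → Fin (p ^ k)) =>
        (e x.1 * ∏ j, b j ^ (x.2 j : ℕ))) := by
  have hp := (Fact.out : p.Prime).pos
  have : NeZero (p ^ k) := ⟨by positivity⟩
  have hs := span_top d (p ^ k) D b e he
  have hfin : Module.Finite (ZMod p) (MvPolynomial (Fin d) (ZMod p) ⧸
      Ideal.span (Set.range fun j => b j ^ (p ^ k))) :=
    Module.Finite.of_fg_top (by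
      rw [← top_le_iff.1 hs]
      exact Submodule.fg_span (Set.finite_range _))
  have hl := linearIndependent_of_top_le_span_of_card_le_finrank hs (by
    have := finrank_lower p d k b
    rw [← hD] at this
    simpa [mul_comm] using this)
  exact LinearIndependent.of_comp (Ideal.Quotient.mkₐ (ZMod p)
    (Ideal.span (Set.range fun j => b j ^ (p ^ k)))).toLinearMap hl

theorem deg_pow_prod {K : Type} [Field K] (d : ℕ) (w db : Fin d → ℕ)
    (b : Fin d → MvPolynomial (Fin d) K) (hb : ∀ i, (b i).IsWeightedHomogeneous w (db i))
    (e : MvPolynomial (Fin d) K) (C : ℕ) (hC : weightedTotalDegree w e ≤ C) (α : Fin d → ℕ)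
    (n : ℕ) (hα : ∑ j, α j * db j ≤ n) (β : Fin d →₀ ℕ)
    (hβ : β ∈ (e * ∏ j, b j ^ α j).support) : ∑ j, β j * w j ≤ n + C := by
  classical
  have h1 : (∏ j, b j ^ α j).IsWeightedHomogeneous w (∑ j, α j * db j) :=
    IsWeightedHomogeneous.prod _ _ _ fun j _ => by simpa using (hb j).pow (α j)
  obtain ⟨γ, hγ, δ, hδ, rfl⟩ := Finset.mem_add.1 (support_mul _ _ hβ)
  have h2 := le_weightedTotalDegree w hγ
  have h3 := h1 (mem_support_iff.1 hδ)
  have hw : ∀ x : Fin d →₀ ℕ, ∑ j, x j * w j = Finsupp.weight w x := by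
    intro x
    rw [Finsupp.weight_apply, Finsupp.sum_fintype] <;> simp
  rw [hw, map_add]
  omega

theorem bezout (p : ℕ) [Fact p.Prime] (d : ℕ) (w db : Fin d → ℕ) (hw : ∀ i, 0 < w i)
    (b : Fin d → MvPolynomial (Fin d) (ZMod p))
    (hb : ∀ i, (b i).IsWeightedHomogeneous w (db i))
    [Module.Finite (ZMod p) (MvPolynomial (Fin d) (ZMod p) ⧸ Ideal.span (Set.range b))] :
    Module.finrank (ZMod p) (MvPolynomial (Fin d) (ZMod p) ⧸ Ideal.span (Set.range b)) *
      ∏ i, w i ≤ ∏ i, db i := by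
  classical
  set I := Ideal.span (Set.range b) with hI
  obtain ⟨D, hD⟩ : ∃ D, D = Module.finrank (ZMod p) (MvPolynomial (Fin d) (ZMod p) ⧸ I) :=
    ⟨_, rfl⟩
  rw [← hD]
  let B := Module.finBasisOfFinrankEq (ZMod p) (MvPolynomial (Fin d) (ZMod p) ⧸ I) hD.symm
  choose e heB using fun i => Ideal.Quotient.mk_surjective (B i)
  have he : ∀ f, ∃ s ∈ Submodule.span (ZMod p) (Set.range e), f - s ∈ I := by
    intro f
    refine ⟨∑ i, B.repr (Ideal.Quotient.mk I f) i • e i, Submodule.sum_mem _ fun i _ =>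
      Submodule.smul_mem _ _ (Submodule.subset_span ⟨i, rfl⟩), ?_⟩
    rw [← Ideal.Quotient.eq]
    have : ∀ (a : ZMod p) f, Ideal.Quotient.mk I (a • f) = a • Ideal.Quotient.mk I f :=
      fun _ _ => rfl
    rw [map_sum]
    simp only [this, heB]
    exact (B.sum_repr _).symm
  have hli := fun k => indep p d k D b e hD he
  have hp1 := (Fact.out : p.Prime).one_lt
  rcases Nat.eq_zero_or_pos D with h0 | hDpos
  · simp [h0]
  have hdb : ∀ i, 0 < db i := by
    intro i
    by_contra hi
    have hi : db i = 0 := by omega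
    -- `b i` is a constant
    have hc : b i = C (coeff 0 (b i)) := by
      ext β
      rw [coeff_C]
      split_ifs with h
      · rw [h]
      · refine (hb i).coeff_eq_zero β ?_
        rw [hi]
        intro hz
        apply h
        ext j
        rw [Finsupp.weight_apply, Finsupp.sum_fintype _ _ (by simp)] at hz
        rw [Finset.sum_eq_zero_iff] at hz
        have := hz j (Finset.mem_univ j)
        have hwj := hw j
        have h3 : β j * w j = 0 := by simpa using this
        rcases Nat.mul_eq_zero.1 h3 with h4 | h4
        · simpa using h4.symm
        · omega
    have hl := hli 1
    have : NeZero (p ^ 1) := ⟨by simp; omega⟩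
    let x0 : Fin D × (Fin d → Fin (p ^ 1)) := (⟨0, hDpos⟩, fun _ => ⟨0, by simp; omega⟩)
    let x1 : Fin D × (Fin d → Fin (p ^ 1)) :=
      (⟨0, hDpos⟩, fun j => if j = i then ⟨1, by simpa using hp1⟩ else ⟨0, by simp; omega⟩)
    have hne : x0 ≠ x1 := by
      intro h
      have := congrArg (fun x => (x.2 i : ℕ)) h
      simp [x0, x1] at this
    have hl2 := hl.comp ![x0, x1] (by
      intro s t hst
      fin_cases s <;> fin_cases t <;> simp_all)
    rw [show (fun x : Fin D × (Fin d → Fin (p ^ 1)) => e x.1 * ∏ j, b j ^ (x.2 j : ℕ)) ∘ ![x0, x1]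
      = ![e x0.1 * ∏ j, b j ^ (x0.2 j : ℕ), e x1.1 * ∏ j, b j ^ (x1.2 j : ℕ)] by
        funext s; fin_cases s <;> rfl] at hl2
    have hpair := (LinearIndependent.pair_iff.1 hl2) (coeff 0 (b i)) (-1)
    have hx1 : ∏ j, b j ^ (x1.2 j : ℕ) = b i := by
      rw [Finset.prod_eq_single i] <;> simp +contextual [x1]
    have hx0 : ∏ j, b j ^ (x0.2 j : ℕ) = 1 := by simp [x0]
    have := hpair (by
      rw [hx1, hx0, smul_eq_C_mul, ← hc]
      simp only [x0, x1, mul_one, neg_smul, one_smul]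
      ring)
    simp at this
  -- counting
  let Cd := ∑ i, weightedTotalDegree w (e i)
  have hCd : ∀ i, weightedTotalDegree w (e i) ≤ Cd := fun i =>
    Finset.single_le_sum (f := fun i => weightedTotalDegree w (e i))
      (fun _ _ => Nat.zero_le _) (Finset.mem_univ i)
  have count : ∀ n, D * (simplexPts d db n).card ≤ (simplexPts d w (n + Cd)).card := by
    intro n
    have hq : n < p ^ n := Nat.lt_pow_self hp1
    have hlt : ∀ α ∈ simplexPts d db n, ∀ j, α j < p ^ n := by
      intro α hα j
      have := (Finset.mem_filter.1 hα).1
      rw [Fintype.mem_piFinset] at this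
      have := Finset.mem_range.1 (this j)
      omega
    let ι : Fin D × simplexPts d db n → Fin D × (Fin d → Fin (p ^ n)) :=
      fun x => (x.1, fun j => ⟨x.2.1 j, hlt _ x.2.2 j⟩)
    have hι : Function.Injective ι := by
      rintro ⟨i, α, hα⟩ ⟨i', α', hα'⟩ h
      simp only [ι, Prod.mk.injEq] at h
      obtain ⟨rfl, h⟩ := h
      have : α = α' := by
        funext j
        simpa using congrFun h j
      subst this
      rfl
    have hl := (hli n).comp ι hι
    let T : Finset (MvPolynomial (Fin d) (ZMod p)) :=
      (simplexPts d w (n + Cd)).image fun β => monomial (Finsupp.equivFunOnFinite.symm β) 1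
    have := linearIndependent_le_span_aux' _ hl (T : Set (MvPolynomial (Fin d) (ZMod p))) (by
      rintro _ ⟨⟨i, α, hα⟩, rfl⟩
      have hα' := (mem_simplexPts hdb).1 hα
      have hdeg := deg_pow_prod d w db b hb (e i) Cd (hCd i) α n hα'
      simp only [Function.comp, ι]
      generalize e i * ∏ j, b j ^ α j = f at hdeg
      change f ∈ _
      rw [f.as_sum]
      refine Submodule.sum_mem _ fun β hβ => ?_
      have : monomial β (coeff β f) = coeff β f • monomial β (1 : ZMod p) := by
        rw [smul_monomial]; simp
      rw [this]
      refine Submodule.smul_mem _ _ (Submodule.subset_span ?_)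
      refine Finset.mem_coe.2 (Finset.mem_image.2 ⟨β, (mem_simplexPts hw).2 (hdeg β hβ), ?_⟩)
      congr 1
      ext; simp)
    have h2 : T.card ≤ _ := Finset.card_image_le
    simp at this
    exact this.trans h2
  refine growth _ _ (Cd + ∑ i, w i) d (fun n => (simplexPts d (fun _ => 1) n).card) ?_
    (fun n => simplex_card_le _ _ _) ?_
  · exact Finset.card_pos.2 ⟨0, (mem_simplexPts (by simp)).2 (by simp)⟩
  · intro n
    calc D * (∏ i, w i) * (simplexPts d (fun _ => 1) n).card
        ≤ D * (∏ i, w i) * ((∏ i, db i) * (simplexPts d db n).card) :=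
          Nat.mul_le_mul_left _ (simplex_le d db hdb n)
      _ = (∏ i, db i) * ((∏ i, w i) * (D * (simplexPts d db n).card)) := by ring
      _ ≤ (∏ i, db i) * ((∏ i, w i) * (simplexPts d w (n + Cd)).card) :=
          Nat.mul_le_mul_left _ (Nat.mul_le_mul_left _ (count n))
      _ ≤ _ := by
          rw [← add_assoc]
          exact Nat.mul_le_mul_left _ (le_simplex d w hw (n + Cd))
open scoped TensorProduct

theorem finiteType_int (d : ℕ) (S : Type) [CommRing S] (f : MvPolynomial (Fin d) ℤ →+* S)
    (hf : Function.Surjective f) : Algebra.FiniteType ℤ S := by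
  let g : MvPolynomial (Fin d) ℤ →ₐ[ℤ] S := aeval fun i => f (X i)
  have hg : (g : MvPolynomial (Fin d) ℤ →+* S) = f := by
    apply MvPolynomial.ringHom_ext
    · intro r; simp
    · intro i; simp [g]
  have hgs : Function.Surjective g := by
    intro y
    obtain ⟨x, rfl⟩ := hf y
    exact ⟨x, RingHom.congr_fun hg x⟩
  exact Algebra.FiniteType.of_surjective g hgs

/-- The key mod `p` statement. -/
theorem mod_p_step (p : ℕ) [Fact p.Prime] (d : ℕ) (w db : Fin d → ℕ) (hw : ∀ i, 0 < w i)
    (b : Fin d → MvPolynomial (Fin d) ℤ)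
    (hb : ∀ i, (b i).IsWeightedHomogeneous w (db i))
    (I : Ideal (MvPolynomial (Fin d) ℤ)) (hI : I = Ideal.span (Set.range b))
    (H : Type) [CommRing H]
    (φ : (MvPolynomial (Fin d) ℤ ⧸ I) →+* H)
    (hsurj : Function.Surjective φ)
    (hfree : Module.Free ℤ H) (hfin : Module.Finite ℤ H)
    (hrank : Module.finrank ℤ H * ∏ i, w i = ∏ i, db i)
    (hK : Module.Finite (ZMod p)
        ((ZMod p) ⊗[ℤ] (MvPolynomial (Fin d) ℤ ⧸ I)))
    (x : MvPolynomial (Fin d) ℤ ⧸ I) (hx : φ x = 0) :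
    ∃ y, φ y = 0 ∧ x = p * y := by
  classical
  have hp0 : (p : ℤ) ≠ 0 := by exact_mod_cast (Fact.out : p.Prime).ne_zero
  let b' : Fin d → MvPolynomial (Fin d) (ZMod p) := fun j => map (Int.castRingHom (ZMod p)) (b j)
  have hb' : ∀ i, (b' i).IsWeightedHomogeneous w (db i) := by
    intro i β hβ
    apply hb i
    intro h
    apply hβ
    simp [b', coeff_map, h]
  let I' := Ideal.span (Set.range b')
  let Q := MvPolynomial (Fin d) (ZMod p) ⧸ I'
  let f : MvPolynomial (Fin d) ℤ →+* Q :=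
    (Ideal.Quotient.mk I').comp (map (Int.castRingHom (ZMod p)))
  have hms : Function.Surjective (map (Int.castRingHom (ZMod p)) : MvPolynomial (Fin d) ℤ →+* _) :=
    map_surjective _ (ZMod.ringHom_surjective _)
  have hfs : Function.Surjective f := Ideal.Quotient.mk_surjective.comp hms
  have hfI : ∀ a ∈ I, f a = 0 := by
    intro a ha
    have : I ≤ RingHom.ker f := by
      rw [hI, Ideal.span_le]
      rintro _ ⟨j, rfl⟩
      refine Ideal.Quotient.eq_zero_iff_mem.2 (Ideal.subset_span ⟨j, rfl⟩)
    exact this ha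
  have hker : ∀ a, f a = 0 → ∃ c, a - p * c ∈ I := by
    intro a ha
    have ha : map (Int.castRingHom (ZMod p)) a ∈ I' := Ideal.Quotient.eq_zero_iff_mem.1 ha
    rw [Ideal.mem_span_range_iff_exists_fun] at ha
    obtain ⟨c', hc'⟩ := ha
    choose c hc using fun j => hms (c' j)
    have h0 : map (Int.castRingHom (ZMod p)) (a - ∑ j, c j * b j) = 0 := by
      rw [map_sub, map_sum, ← hc', sub_eq_zero]
      simp [hc, b']
    have hdvd : C (p : ℤ) ∣ a - ∑ j, c j * b j := by
      rw [C_dvd_iff_map_hom_eq_zero (Int.castRingHom (ZMod p)) (p : ℤ)]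
      · exact h0
      · intro r; simpa using ZMod.intCast_zmod_eq_zero_iff_dvd r p
    obtain ⟨g, hg⟩ := hdvd
    refine ⟨g, ?_⟩
    have : a - p * g = ∑ j, c j * b j := by
      have : (C (p : ℤ) : MvPolynomial (Fin d) ℤ) = p := by simp
      rw [this] at hg
      rw [← hg]; ring
    rw [this]
    exact Ideal.sum_mem _ fun j _ => I.mul_mem_left _ (hI ▸ Ideal.subset_span ⟨j, rfl⟩)
  let f1 : (MvPolynomial (Fin d) ℤ ⧸ I) →+* Q := Ideal.Quotient.lift I f hfI
  have hQ : Module.Finite (ZMod p) Q := by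
    let F : (ZMod p) ⊗[ℤ] (MvPolynomial (Fin d) ℤ ⧸ I) →ₐ[ZMod p] Q :=
      Algebra.TensorProduct.lift (Algebra.ofId (ZMod p) Q) f1.toIntAlgHom
        (fun _ _ => Commute.all _ _)
    refine Module.Finite.of_surjective F.toLinearMap ?_
    intro y
    obtain ⟨a, rfl⟩ := hfs y
    refine ⟨1 ⊗ₜ Ideal.Quotient.mk I a, ?_⟩
    change F (1 ⊗ₜ Ideal.Quotient.mk I a) = f a
    refine (Algebra.TensorProduct.lift_tmul (Algebra.ofId (ZMod p) Q) f1.toIntAlgHom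
      (fun _ _ => Commute.all _ _) 1 (Ideal.Quotient.mk I a)).trans ?_
    rw [map_one, one_mul]
    rfl
  have hbez := bezout p d w db hw b' hb'
  rw [← hrank] at hbez
  have hle : Module.finrank (ZMod p) Q ≤ Module.finrank ℤ H :=
    Nat.le_of_mul_le_mul_right hbez (Finset.prod_pos fun i _ => hw i)
  -- the map to `H / p H`
  let PH : Ideal H := Ideal.span {(p : H)}
  let g1 : (MvPolynomial (Fin d) ℤ ⧸ I) →+* H ⧸ PH := (Ideal.Quotient.mk PH).comp φ
  have hg1 : Function.Surjective g1 := Ideal.Quotient.mk_surjective.comp hsurj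
  have hpg : ∀ c, g1 (p * c) = 0 := by
    intro c
    refine Ideal.Quotient.eq_zero_iff_mem.2 ?_
    rw [map_mul, map_natCast]
    exact PH.mul_mem_right _ (Ideal.mem_span_singleton_self _)
  have hkk : ∀ a, f a = 0 → g1 (Ideal.Quotient.mk I a) = 0 := by
    intro a ha
    obtain ⟨c, hc⟩ := hker a ha
    have := Ideal.Quotient.eq.2 hc
    rw [this, map_mul, map_natCast, hpg]
  have hcard : Finite (H ⧸ PH) → p ^ Module.finrank ℤ H ≤ Nat.card (H ⧸ PH) := by
    intro hfinH
    let B := Module.finBasis ℤ H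
    let ψ : H →+ (Fin (Module.finrank ℤ H) → ZMod p) :=
      { toFun := fun h i => ((B.repr h i : ℤ) : ZMod p)
        map_zero' := by funext i; simp
        map_add' := fun x y => by funext i; simp }
    have hψs : Function.Surjective ψ := by
      intro v
      choose u hu using fun i => ZMod.intCast_surjective (v i)
      refine ⟨B.equivFun.symm u, funext fun i => ?_⟩
      have : B.repr (B.equivFun.symm u) i = u i := congrFun (B.equivFun.apply_symm_apply u) i
      change ((B.repr (B.equivFun.symm u) i : ℤ) : ZMod p) = v i
      rw [this, hu]
    have hψ0 : ∀ a ∈ PH, ψ a = 0 := by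
      intro a ha
      obtain ⟨c, rfl⟩ := Ideal.mem_span_singleton.1 ha
      rw [← nsmul_eq_mul, map_nsmul]
      funext i
      simp
    let ψ' : H ⧸ PH → (Fin (Module.finrank ℤ H) → ZMod p) := fun z => ψ (Quotient.out z)
    have hψ' : Function.Surjective ψ' := by
      intro v
      obtain ⟨h, rfl⟩ := hψs v
      refine ⟨Ideal.Quotient.mk PH h, ?_⟩
      have h1 : Ideal.Quotient.mk PH (Quotient.out (Ideal.Quotient.mk PH h))
          = Ideal.Quotient.mk PH h := Quotient.out_eq _
      have h2 := hψ0 _ (Ideal.Quotient.eq.1 h1)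
      rw [map_sub, sub_eq_zero] at h2
      exact h2
    have := Nat.card_le_card_of_surjective ψ' hψ'
    simpa using this
  have hcardQ : Nat.card Q = p ^ Module.finrank (ZMod p) Q := by
    rw [Module.natCard_eq_pow_finrank (K := ZMod p), Nat.card_zmod]
  have hQfin : Finite Q := Module.finite_of_finite (ZMod p)
  let s : Q → MvPolynomial (Fin d) ℤ := Function.surjInv hfs
  have hs : ∀ y, f (s y) = y := Function.surjInv_eq hfs
  let θ : Q → H ⧸ PH := fun y => g1 (Ideal.Quotient.mk I (s y))
  have hθ : ∀ a, θ (f a) = g1 (Ideal.Quotient.mk I a) := by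
    intro a
    have := hkk (s (f a) - a) (by rw [map_sub, hs, sub_self])
    rw [map_sub, map_sub, sub_eq_zero] at this
    exact this
  have hθs : Function.Surjective θ := by
    intro z
    obtain ⟨m, rfl⟩ := hg1 z
    obtain ⟨a, rfl⟩ := Ideal.Quotient.mk_surjective m
    exact ⟨f a, hθ a⟩
  have hθi : Function.Injective θ := by
    have hfinH : Finite (H ⧸ PH) := Finite.of_surjective θ hθs
    refine ((Function.Surjective.bijective_of_nat_card_le hθs) ?_).1
    rw [hcardQ]
    exact (Nat.pow_le_pow_right (Fact.out : p.Prime).pos hle).trans (hcard hfinH)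
  obtain ⟨a, rfl⟩ := Ideal.Quotient.mk_surjective x
  have hfa : f a = 0 := by
    apply hθi
    have h0 : θ 0 = 0 := by
      have := hθ 0
      simpa using this
    rw [hθ, h0]
    change Ideal.Quotient.mk PH (φ _) = 0
    rw [hx, map_zero]
  obtain ⟨c, hc⟩ := hker a hfa
  have hac := Ideal.Quotient.eq.2 hc
  rw [map_mul, map_natCast] at hac
  refine ⟨Ideal.Quotient.mk I c, ?_, hac⟩
  rw [hac, map_mul, map_natCast] at hx
  have : (p : ℤ) • φ (Ideal.Quotient.mk I c) = 0 := by
    rw [zsmul_eq_mul]; simpa using hx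
  exact (smul_eq_zero.1 this).resolve_left hp0

/-- **Reid's lemma.** Let `R = ℤ[a_1,…,a_d]` be graded with `deg a_i = w i > 0`, let
`I ⊆ R` be an ideal generated by homogeneous elements `b_1,…,b_d` of degrees `db i`,
and let `φ : R/I → H` be a surjective ring homomorphism.  If (i) `H` is a free
`ℤ`-module of rank `∏ i, db i / w i`, and (ii) for every field `K` the `K`-vector
space `(R/I) ⊗_ℤ K` is finite dimensional, then `φ` is an isomorphism. -/
theorem reid_presentation_lemma (d : ℕ) (w db : Fin d → ℕ) (hw : ∀ i, 0 < w i)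
    (b : Fin d → MvPolynomial (Fin d) ℤ)
    (hb : ∀ i, (b i).IsWeightedHomogeneous w (db i))
    (H : Type) [CommRing H]
    (φ : (MvPolynomial (Fin d) ℤ ⧸ Ideal.span (Set.range b)) →+* H)
    (hsurj : Function.Surjective φ)
    (hfree : Module.Free ℤ H) (hfin : Module.Finite ℤ H)
    (hrank : Module.finrank ℤ H * ∏ i, w i = ∏ i, db i)
    (hK : ∀ (K : Type) [Field K],
      Module.Finite K
        (K ⊗[ℤ] (MvPolynomial (Fin d) ℤ ⧸ Ideal.span (Set.range b)))) :
    Function.Bijective φ := by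
  refine ⟨?_, hsurj⟩
  rw [RingHom.injective_iff_ker_eq_bot]
  refine @eq_bot_of_divisible _ _ (finiteType_int d _ _ Ideal.Quotient.mk_surjective) _ ?_
  intro p hp x hx
  have : Fact p.Prime := ⟨hp⟩
  obtain ⟨y, hy, h⟩ := mod_p_step p d w db hw b hb _ rfl H φ hsurj hfree hfin hrank (hK (ZMod p)) x hx
  exact ⟨y, hy, h⟩
end

section
/- Fix integers d ≥ 1 and m ≥ 0. In the polynomial ring ℤ[a_1,…,a_d], with the conventions a_0 = 1 and a_i = 0 for i < 0 or i > d, let d_r = det(a_{1+j−i})_{1≤i,j≤r} denote the r × r Schur determinant. Then the quotient of ℤ[a_1,…,a_d] by the ideal generated by d_r for m+1 ≤ r ≤ m+d is a free ℤ-module of rank binom(m+d, d). -/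
open MvPolynomial

/-- The element `a_i` of `ℤ[a_1,…,a_d]`, with the conventions `a_0 = 1` and
`a_i = 0` for `i < 0` or `i > d`. -/
noncomputable def aGen (d : ℕ) (i : ℤ) : MvPolynomial (Fin d) ℤ :=
  if h : 1 ≤ i ∧ i ≤ d then X ⟨i.toNat - 1, by omega⟩
  else if i = 0 then 1 else 0

/-- The `r × r` Schur determinant `d_r = det (a_{1+j-i})_{1 ≤ i,j ≤ r}`. -/
noncomputable def schurDet (d : ℕ) (r : ℕ) : MvPolynomial (Fin d) ℤ :=
  (Matrix.of fun i j : Fin r => aGen d (1 + (j : ℤ) - (i : ℤ))).det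

/-- Splitting off a linear factor of a monic polynomial. -/
lemma monic_split {S : Type} [CommRing S] [Nontrivial S] {k : ℕ} (q : Polynomial S)
    (hq : q.Monic) (hk : q.natDegree = k + 1) (x : S) (hx : q.eval x = 0) :
    ∃ q1 : Polynomial S, q1.Monic ∧ q1.natDegree = k ∧
      q = (Polynomial.X - Polynomial.C x) * q1 := by
  obtain ⟨q1, h1⟩ := Polynomial.dvd_iff_isRoot.mpr hx
  have hm : q1.Monic := (Polynomial.monic_X_sub_C x).of_mul_monic_left (h1 ▸ hq)
  refine ⟨q1, hm, ?_, h1⟩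
  have := (Polynomial.monic_X_sub_C x).natDegree_mul hm
  rw [← h1, hk, Polynomial.natDegree_X_sub_C] at this
  omega

/-- `(A, g)` is the universal monic degree `d` divisor of `p`. -/
structure IsUnivDiv {R A : Type} [CommRing R] [CommRing A] (i : R →+* A)
    (p : Polynomial R) (d : ℕ) (g : Polynomial A) : Prop where
  monic : g.Monic
  deg : g.natDegree = d
  dvd : g ∣ p.map i
  ex : ∀ (S : Type) [CommRing S] [Nontrivial S] (j : R →+* S) (g' : Polynomial S),
    g'.Monic → g'.natDegree = d → g' ∣ p.map j → ∃ f : A →+* S, f.comp i = j ∧ g.map f = g'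
  uniq : ∀ (S : Type) [CommRing S] [Nontrivial S] (f1 f2 : A →+* S),
    f1.comp i = f2.comp i → g.map f1 = g.map f2 → f1 = f2

lemma IsUnivDiv.step {R A : Type} [CommRing R] [CommRing A] [Nontrivial R] [Nontrivial A]
    (i : R →+* A) (p : Polynomial R) (d n : ℕ) (g : Polynomial A) (hp : p.Monic)
    (hn : p.natDegree = n + 1) (H : IsUnivDiv i p (d + 1) g) :
    ∃ (i1 : AdjoinRoot p →+* AdjoinRoot g) (p1 : Polynomial (AdjoinRoot p))
      (g1 : Polynomial (AdjoinRoot g)), Nontrivial (AdjoinRoot p) ∧ Nontrivial (AdjoinRoot g) ∧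
      i1.comp (AdjoinRoot.of p) = (AdjoinRoot.of g).comp i ∧
      p1.Monic ∧ p1.natDegree = n ∧ IsUnivDiv i1 p1 d g1 := by
  have hgd : g.degree ≠ 0 := by
    rw [Polynomial.degree_eq_natDegree H.monic.ne_zero, H.deg]; exact_mod_cast Nat.succ_ne_zero d
  have hpd : p.degree ≠ 0 := by
    rw [Polynomial.degree_eq_natDegree hp.ne_zero, hn]; exact_mod_cast Nat.succ_ne_zero n
  have nB : Nontrivial (AdjoinRoot g) := by
    rw [AdjoinRoot, Ideal.Quotient.nontrivial_iff, Ne, Ideal.span_singleton_eq_top]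
    intro h
    have := H.monic.eq_one_of_isUnit h
    simp [this] at hgd
  have nR : Nontrivial (AdjoinRoot p) := by
    rw [AdjoinRoot, Ideal.Quotient.nontrivial_iff, Ne, Ideal.span_singleton_eq_top]
    intro h
    have := hp.eq_one_of_isUnit h
    simp [this] at hpd
  have hroot : p.eval₂ ((AdjoinRoot.of g).comp i) (AdjoinRoot.root g) = 0 := by
    obtain ⟨h, hh⟩ := H.dvd
    rw [← Polynomial.eval₂_map, hh, Polynomial.eval₂_mul, AdjoinRoot.eval₂_root, zero_mul]
  let i1 : AdjoinRoot p →+* AdjoinRoot g := AdjoinRoot.lift _ _ hroot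
  have hi1 : i1.comp (AdjoinRoot.of p) = (AdjoinRoot.of g).comp i :=
    RingHom.ext fun x => AdjoinRoot.lift_of hroot
  have hi1r : i1 (AdjoinRoot.root p) = AdjoinRoot.root g := AdjoinRoot.lift_root hroot
  obtain ⟨p1, hp1, hp1d, hp1e⟩ := monic_split (p.map (AdjoinRoot.of p)) (hp.map _)
    (by rw [hp.natDegree_map, hn]) (AdjoinRoot.root p)
    (by rw [Polynomial.eval_map, AdjoinRoot.eval₂_root])
  obtain ⟨g1, hg1, hg1d, hg1e⟩ := monic_split (g.map (AdjoinRoot.of g)) (H.monic.map _)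
    (by rw [H.monic.natDegree_map, H.deg]) (AdjoinRoot.root g)
    (by rw [Polynomial.eval_map, AdjoinRoot.eval₂_root])
  refine ⟨i1, p1, g1, nR, nB, hi1, hp1, hp1d, hg1, hg1d, ?_, ?_, ?_⟩
  · obtain ⟨h, hh⟩ := H.dvd
    refine ⟨h.map (AdjoinRoot.of g), ?_⟩
    apply (Polynomial.monic_X_sub_C (AdjoinRoot.root g)).isRegular.left
    have h1 := congrArg (Polynomial.map i1) hp1e
    rw [Polynomial.map_map, hi1, ← Polynomial.map_map, hh, Polynomial.map_mul, hg1e,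
      Polynomial.map_mul] at h1
    simp only [Polynomial.map_sub, Polynomial.map_X, Polynomial.map_C, hi1r] at h1
    simp only [← mul_assoc]
    exact h1.symm
  · intro S _ _ j g' hg' hg'd hdvd
    have hX := Polynomial.monic_X_sub_C (j (AdjoinRoot.root p))
    obtain ⟨f, hf, hfg⟩ := H.ex S (j.comp (AdjoinRoot.of p))
      ((Polynomial.X - Polynomial.C (j (AdjoinRoot.root p))) * g')
      (hX.mul hg') (by rw [hX.natDegree_mul hg', hg'd, Polynomial.natDegree_X_sub_C, add_comm])
      (by
        rw [← Polynomial.map_map, hp1e, Polynomial.map_mul]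
        simp only [Polynomial.map_sub, Polynomial.map_X, Polynomial.map_C]
        exact mul_dvd_mul_left _ hdvd)
    have hr : g.eval₂ f (j (AdjoinRoot.root p)) = 0 := by
      rw [← Polynomial.eval_map, hfg]; simp
    refine ⟨AdjoinRoot.lift f _ hr, ?_, ?_⟩
    · apply Ideal.Quotient.ringHom_ext
      apply Polynomial.ringHom_ext
      · intro a
        have h1 : i1 (AdjoinRoot.of p a) = AdjoinRoot.of g (i a) := RingHom.congr_fun hi1 a
        have h2 : f (i a) = j (AdjoinRoot.of p a) := RingHom.congr_fun hf a
        change AdjoinRoot.lift f _ hr (i1 (AdjoinRoot.of p a)) = j (AdjoinRoot.of p a)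
        rw [h1, AdjoinRoot.lift_of, h2]
      · change AdjoinRoot.lift f _ hr (i1 (AdjoinRoot.root p)) = j (AdjoinRoot.root p)
        rw [hi1r, AdjoinRoot.lift_root]
    · apply hX.isRegular.left
      have h1 := congrArg (Polynomial.map (AdjoinRoot.lift f _ hr)) hg1e
      have h2 : (AdjoinRoot.lift f _ hr).comp (AdjoinRoot.of g) = f :=
        RingHom.ext fun x => AdjoinRoot.lift_of hr
      rw [Polynomial.map_map, h2, hfg, Polynomial.map_mul] at h1
      simp only [Polynomial.map_sub, Polynomial.map_X, Polynomial.map_C,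
        AdjoinRoot.lift_root] at h1
      exact h1.symm
  · intro S _ _ f1 f2 hc hg
    have hrt : f1 (AdjoinRoot.root g) = f2 (AdjoinRoot.root g) := by
      rw [← hi1r]; exact RingHom.congr_fun hc _
    have hA : f1.comp (AdjoinRoot.of g) = f2.comp (AdjoinRoot.of g) := by
      apply H.uniq
      · rw [RingHom.comp_assoc, RingHom.comp_assoc, ← hi1, ← RingHom.comp_assoc, hc,
          RingHom.comp_assoc]
      · rw [← Polynomial.map_map, ← Polynomial.map_map, hg1e, Polynomial.map_mul,
          Polynomial.map_mul, hg]
        simp [hrt]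
    apply Ideal.Quotient.ringHom_ext
    apply Polynomial.ringHom_ext
    · intro a; exact RingHom.congr_fun hA a
    · exact hrt

/-- `AdjoinRoot` of a monic polynomial is free, in coordinates. -/
lemma adjoinRoot_coords {R : Type} [CommRing R] (p : Polynomial R) (hp : p.Monic) (n : ℕ)
    (hn : p.natDegree = n) :
    ∃ φ : AdjoinRoot p ≃+ (Fin n → R), ∀ r x, φ (AdjoinRoot.of p r * x) = fun k => r * φ x k := by
  subst hn
  refine ⟨(AdjoinRoot.powerBasis' hp).basis.equivFun.toAddEquiv, fun r x => ?_⟩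
  have := (AdjoinRoot.powerBasis' hp).basis.equivFun.map_smul r x
  rw [Algebra.smul_def] at this
  exact this

theorem IsUnivDiv.coords (d : ℕ) : ∀ {R A : Type} [CommRing R] [CommRing A] [Nontrivial R]
    [Nontrivial A] (i : R →+* A) (p : Polynomial R) (m : ℕ) (g : Polynomial A), p.Monic →
    p.natDegree = m + d → IsUnivDiv i p d g →
    ∃ (ι κ : Type) (_ : Fintype ι) (_ : Fintype κ) (_ : Nonempty ι),
      Fintype.card κ = Fintype.card ι * (m + d).choose d ∧
      ∃ φ : (ι → A) ≃+ (κ → R), ∀ r x, φ (fun k => i r * x k) = fun k => r * φ x k := by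
  induction d with
  | zero =>
    intro R A _ _ _ _ i p m g hp hn H
    have hg1 : g = 1 := H.monic.natDegree_eq_zero.mp H.deg
    obtain ⟨f, hf, -⟩ := H.ex R (RingHom.id R) 1 Polynomial.monic_one (by simp) (one_dvd _)
    have h2 : i.comp f = RingHom.id A := by
      apply H.uniq
      · rw [RingHom.comp_assoc, hf]; rfl
      · simp [hg1]
    let e : A ≃+* R := RingEquiv.ofRingHom f i hf h2
    refine ⟨Unit, Unit, inferInstance, inferInstance, inferInstance, by simp,
      AddEquiv.piCongrRight fun _ => e.toAddEquiv, ?_⟩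
    intro r x
    funext k
    change f (i r * x k) = r * f (x k)
    rw [map_mul]
    congr 1
    exact RingHom.congr_fun hf r
  | succ d ih =>
    intro R A _ _ _ _ i p m g hp hn H
    obtain ⟨i1, p1, g1, nR, nB, hi, hp1, hp1d, H1⟩ := H.step i p d (m + d) g hp hn
    obtain ⟨ι, κ, _, _, _, hcard, φ, hφ⟩ := ih i1 p1 m g1 hp1 hp1d H1
    obtain ⟨α, hα⟩ := adjoinRoot_coords g H.monic (d + 1) H.deg
    obtain ⟨β, hβ⟩ := adjoinRoot_coords p hp (m + d + 1) hn
    refine ⟨ι × Fin (d + 1), κ × Fin (m + d + 1), inferInstance, inferInstance, inferInstance,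
      ?_, ?_⟩
    · simp only [Fintype.card_prod, Fintype.card_fin, hcard]
      have := Nat.add_one_mul_choose_eq (m + d) d
      rw [show m + (d + 1) = m + d + 1 by ring]
      linear_combination Fintype.card ι * this
    · let e1 : (ι × Fin (d + 1) → A) ≃+ (ι → Fin (d + 1) → A) :=
        { Equiv.curry _ _ _ with map_add' := fun _ _ => rfl }
      let e2 : (κ × Fin (m + d + 1) → R) ≃+ (κ → Fin (m + d + 1) → R) :=
        { Equiv.curry _ _ _ with map_add' := fun _ _ => rfl }
      refine ⟨e1.trans ((AddEquiv.piCongrRight fun _ => α.symm).trans (φ.trans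
        ((AddEquiv.piCongrRight fun _ => β).trans e2.symm))), ?_⟩
      intro r x
      have h1 : (AddEquiv.piCongrRight fun _ : ι => α.symm) (e1 (fun k => i r * x k)) =
          fun k => i1 (AdjoinRoot.of p r) * (AddEquiv.piCongrRight fun _ : ι => α.symm) (e1 x) k := by
        funext k
        apply α.injective
        have h2 : i1 (AdjoinRoot.of p r) = AdjoinRoot.of g (i r) := RingHom.congr_fun hi r
        change α (α.symm (fun l => i r * x (k, l))) =
          α (i1 (AdjoinRoot.of p r) * α.symm (fun l => x (k, l)))
        rw [h2, hα, AddEquiv.apply_symm_apply, AddEquiv.apply_symm_apply]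
      simp only [AddEquiv.trans_apply]
      rw [h1, hφ]
      funext k
      change β (AdjoinRoot.of p r * φ _ k.1) k.2 = r * β (φ _ k.1) k.2
      rw [hβ]

/-- The polynomial `∑ a_i T^i`. -/
noncomputable def aPoly (d : ℕ) : Polynomial (MvPolynomial (Fin d) ℤ) :=
  ∑ k ∈ Finset.range (d + 1), Polynomial.monomial k (aGen d k)

lemma aPoly_coeff (d k : ℕ) : (aPoly d).coeff k = aGen d k := by
  simp only [aPoly, Polynomial.finsetSum_coeff, Polynomial.coeff_monomial]
  rw [Finset.sum_ite_eq']
  split_ifs with h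
  · rfl
  · simp only [Finset.mem_range] at h
    rw [aGen, dif_neg (by omega), if_neg (by omega)]

lemma aGen_zero (d : ℕ) : aGen d 0 = 1 := by
  rw [aGen, dif_neg (by omega), if_pos rfl]

lemma aGen_neg (d : ℕ) (i : ℤ) (h : i < 0) : aGen d i = 0 := by
  rw [aGen, dif_neg (by omega), if_neg (by omega)]

lemma aGen_succ (d : ℕ) (i : Fin d) : aGen d ((i : ℕ) + 1 : ℕ) = X i := by
  rw [aGen, dif_pos (by have := i.2; omega)]
  congr 1

lemma aPoly_natDegree_le (d : ℕ) : (aPoly d).natDegree ≤ d := by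
  rw [Polynomial.natDegree_le_iff_coeff_eq_zero]
  intro N hN
  rw [aPoly_coeff, aGen, dif_neg (by omega), if_neg (by omega)]

/-- The Schur determinants are, up to sign, the coefficients of the inverse series. -/
lemma schurDet_eq (d : ℕ) (w : PowerSeries (MvPolynomial (Fin d) ℤ))
    (hw : w * (aPoly d : PowerSeries (MvPolynomial (Fin d) ℤ)) = 1) (r : ℕ) :
    schurDet d r = (-1) ^ r * PowerSeries.coeff r w := by
  have hrec : ∀ k, ∑ i ∈ Finset.range (k + 1), PowerSeries.coeff i w * aGen d ((k : ℤ) - i) =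
      if k = 0 then 1 else 0 := by
    intro k
    have := congrArg (PowerSeries.coeff k) hw
    rw [PowerSeries.coeff_mul, PowerSeries.coeff_one,
      Finset.Nat.sum_antidiagonal_eq_sum_range_succ_mk] at this
    rw [← this]
    refine Finset.sum_congr rfl fun i hi => ?_
    simp only [Finset.mem_range] at hi
    rw [Polynomial.coeff_coe, aPoly_coeff, Nat.cast_sub (by omega)]
  have hw0 : PowerSeries.coeff 0 w = 1 := by
    have := hrec 0
    simpa [aGen_zero] using this
  cases r with
  | zero => simp [schurDet, hw0]
  | succ r =>
    set M : Matrix (Fin (r + 1)) (Fin (r + 1)) (MvPolynomial (Fin d) ℤ) :=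
      Matrix.of fun i j => aGen d (1 + (j : ℤ) - (i : ℤ)) with hM
    have h1 := Matrix.det_updateRow_sum M 0 (fun k => PowerSeries.coeff (k : ℕ) w)
    simp only [Fin.val_zero, hw0, one_smul] at h1
    have hrow : ∀ j : Fin (r + 1), (∑ k : Fin (r + 1), PowerSeries.coeff (k : ℕ) w • M k) j =
        if j = Fin.last r then - PowerSeries.coeff (r + 1) w else 0 := by
      intro j
      have h2 := hrec (j + 1)
      rw [if_neg (by omega)] at h2
      have h3 : (∑ k : Fin (r + 1), PowerSeries.coeff (k : ℕ) w • M k) j =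
          ∑ k ∈ Finset.range (r + 1), PowerSeries.coeff k w * aGen d (((j + 1 : ℕ) : ℤ) - k) := by
        rw [Finset.sum_apply, Finset.sum_range]
        refine Finset.sum_congr rfl fun k _ => ?_
        simp only [Pi.smul_apply, smul_eq_mul, hM, Matrix.of_apply]
        push_cast
        rw [add_comm (1 : ℤ)]
      rw [h3]
      split_ifs with hj
      · subst hj
        rw [Fin.val_last] at h2 ⊢
        rw [Finset.sum_range_succ, sub_self, aGen_zero, mul_one] at h2
        exact eq_neg_of_add_eq_zero_left h2
      · have hj' : (j : ℕ) < r := by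
          have := j.2
          have h4 : (j : ℕ) ≠ r := fun h => hj (Fin.ext h)
          omega
        rw [← h2]
        symm
        apply Finset.sum_subset
        · intro x hx; simp only [Finset.mem_range] at *; omega
        · intro x _ hx
          simp only [Finset.mem_range] at hx
          rw [aGen_neg _ _ (by omega), mul_zero]
    change M.det = _
    rw [← h1, Matrix.det_succ_row_zero, Finset.sum_eq_single (Fin.last r)]
    · rw [Matrix.updateRow_self, hrow, if_pos rfl]
      have hsub : ((M.updateRow 0 (∑ k : Fin (r + 1), PowerSeries.coeff (k : ℕ) w • M k)).submatrix
          Fin.succ (Fin.last r).succAbove).det = 1 := by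
        rw [Matrix.det_of_isUpperTriangular]
        · apply Finset.prod_eq_one
          intro k _
          rw [Matrix.submatrix_apply, Matrix.updateRow_ne (Fin.succ_ne_zero k), hM,
            Matrix.of_apply, Fin.succAbove_last]
          rw [← aGen_zero d]
          congr 1
          simp only [Fin.val_castSucc, Fin.val_succ]
          push_cast
          ring
        · intro a b hab
          have hab' : (b : ℕ) < a := hab
          rw [Matrix.submatrix_apply, Matrix.updateRow_ne (Fin.succ_ne_zero a), hM,
            Matrix.of_apply, Fin.succAbove_last]
          apply aGen_neg
          simp only [Fin.val_castSucc, Fin.val_succ]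
          omega
      rw [hsub, Fin.val_last]
      ring
    · intro j _ hj
      rw [Matrix.updateRow_self, hrow, if_neg hj]
      ring
    · simp

/-- The inverse power series exists. -/
lemma exists_inv (d : ℕ) : ∃ w : PowerSeries (MvPolynomial (Fin d) ℤ),
    w * (aPoly d : PowerSeries (MvPolynomial (Fin d) ℤ)) = 1 := by
  refine ⟨PowerSeries.invOfUnit (aPoly d : PowerSeries (MvPolynomial (Fin d) ℤ)) 1, ?_⟩
  rw [mul_comm]
  apply PowerSeries.mul_invOfUnit
  rw [← PowerSeries.coeff_zero_eq_constantCoeff_apply, Polynomial.coeff_coe, aPoly_coeff]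
  simp [aGen_zero]

/-- The defining ideal. -/
noncomputable abbrev sIdeal (d m : ℕ) : Ideal (MvPolynomial (Fin d) ℤ) :=
  Ideal.span (schurDet d '' Set.Icc (m + 1) (m + d))

lemma reflect_X_pow {S : Type} [CommRing S] (n : ℕ) :
    Polynomial.reflect n (Polynomial.X ^ n : Polynomial S) = 1 := by
  have := Polynomial.reflect_C_mul_X_pow n n (c := (1 : S))
  simpa [Polynomial.revAt_le le_rfl] using this

lemma reflect_one' {S : Type} [CommRing S] (n : ℕ) :
    Polynomial.reflect n (1 : Polynomial S) = Polynomial.X ^ n := by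
  have := Polynomial.reflect_C_mul_X_pow n 0 (c := (1 : S))
  simpa using this

/-- A ring hom kills the Schur determinants `d_r`, `r > m`, when the corresponding
polynomial divides `T^(m+d)`. -/
lemma kills (d m : ℕ) {S : Type} [CommRing S] [Nontrivial S] (f : MvPolynomial (Fin d) ℤ →+* S)
    (g h : Polynomial S) (hg : g.Monic) (hd : g.natDegree = d)
    (hf : (aPoly d).map f = Polynomial.reflect d g)
    (hgh : (Polynomial.X : Polynomial S) ^ (m + d) = g * h) (r : ℕ) (hr : m < r) :
    f (schurDet d r) = 0 := by
  obtain ⟨w, hw⟩ := exists_inv d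
  have hhm : h.Monic := hg.of_mul_monic_left (hgh ▸ Polynomial.monic_X_pow _)
  have hhd : h.natDegree = m := by
    have := hg.natDegree_mul hhm
    rw [← hgh, Polynomial.natDegree_X_pow] at this
    omega
  have h1 : Polynomial.reflect d g * Polynomial.reflect m h = 1 := by
    rw [← Polynomial.reflect_mul g h hd.le hhd.le, ← hgh, add_comm d m, reflect_X_pow]
  have h2 : PowerSeries.map f w * ((Polynomial.reflect d g : Polynomial S) : PowerSeries S) = 1 := by
    rw [← hf, Polynomial.polynomial_map_coe, ← map_mul, hw, map_one]
  have h3 : PowerSeries.map f w = ((Polynomial.reflect m h : Polynomial S) : PowerSeries S) := by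
    have h4 := congrArg (fun q : Polynomial S => (q : PowerSeries S)) h1
    simp only [Polynomial.coe_mul, Polynomial.coe_one] at h4
    exact left_inv_eq_right_inv h2 h4
  have h5 : f (PowerSeries.coeff r w) = 0 := by
    rw [← PowerSeries.coeff_map, h3, Polynomial.coeff_coe, Polynomial.coeff_reflect,
      Polynomial.revAt_eq_self_of_lt hr]
    exact Polynomial.coeff_eq_zero_of_natDegree_lt (by omega)
  rw [schurDet_eq d w hw r, map_mul, h5, mul_zero]

lemma exists_hom (d m : ℕ) {S : Type} [CommRing S] [Nontrivial S] 
    (g : Polynomial S) (hg : g.Monic) (hd : g.natDegree = d)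
    (hgh : g ∣ (Polynomial.X : Polynomial S) ^ (m + d)) :
    ∃ f : MvPolynomial (Fin d) ℤ ⧸ sIdeal d m →+* S,
      ((Polynomial.reflect d (aPoly d)).map (Ideal.Quotient.mk (sIdeal d m))).map f = g := by
  let f0 : MvPolynomial (Fin d) ℤ →+* S :=
    MvPolynomial.eval₂Hom (Int.castRingHom S) (fun i => g.coeff (d - (i + 1)))
  have hf : (aPoly d).map f0 = Polynomial.reflect d g := by
    ext k
    rw [Polynomial.coeff_map, aPoly_coeff, Polynomial.coeff_reflect]
    rcases Nat.lt_or_ge d k with hk | hk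
    · rw [Polynomial.revAt_eq_self_of_lt hk, Polynomial.coeff_eq_zero_of_natDegree_lt (by omega),
        aGen, dif_neg (by omega), if_neg (by omega), map_zero]
    · rw [Polynomial.revAt_le hk]
      rcases k with _ | k
      · rw [Nat.cast_zero, aGen_zero, map_one, Nat.sub_zero, ← hd]
        exact hg.coeff_natDegree.symm
      · rw [aGen_succ d ⟨k, hk⟩]
        simp [f0]
  obtain ⟨h, hh⟩ := hgh
  have hk : ∀ a ∈ sIdeal d m, f0 a = 0 := by
    intro a ha
    have : sIdeal d m ≤ RingHom.ker f0 := by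
      rw [sIdeal, Ideal.span_le]
      rintro _ ⟨r, hr, rfl⟩
      exact kills d m f0 g h hg hd hf hh r (by have := hr.1; omega)
    exact this ha
  refine ⟨Ideal.Quotient.lift _ f0 hk, ?_⟩
  rw [Polynomial.map_map, Ideal.Quotient.lift_comp_mk, ← Polynomial.reflect_map, hf]
  exact Polynomial.reflect_reflect

lemma schur_univ (d m : ℕ) (hd : 1 ≤ d) [Nontrivial (MvPolynomial (Fin d) ℤ ⧸ sIdeal d m)] :
    IsUnivDiv (Int.castRingHom (MvPolynomial (Fin d) ℤ ⧸ sIdeal d m))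
      (Polynomial.X ^ (m + d)) d
      ((Polynomial.reflect d (aPoly d)).map (Ideal.Quotient.mk (sIdeal d m))) := by
  have hle : (Polynomial.reflect d (aPoly d)).natDegree ≤ d := by
    rw [Polynomial.natDegree_le_iff_coeff_eq_zero]
    intro N hN
    rw [Polynomial.coeff_reflect, Polynomial.revAt_eq_self_of_lt hN]
    exact Polynomial.coeff_eq_zero_of_natDegree_lt (by have := aPoly_natDegree_le d; omega)
  have hle' := (Polynomial.natDegree_map_le (f := Ideal.Quotient.mk (sIdeal d m))
    (p := Polynomial.reflect d (aPoly d))).trans hle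
  have hc : ((Polynomial.reflect d (aPoly d)).map (Ideal.Quotient.mk (sIdeal d m))).coeff d = 1 := by
    rw [Polynomial.coeff_map, Polynomial.coeff_reflect, Polynomial.revAt_le le_rfl, Nat.sub_self,
      aPoly_coeff, Nat.cast_zero, aGen_zero, map_one]
  refine ⟨Polynomial.monic_of_natDegree_le_of_coeff_eq_one d hle' hc,
    Polynomial.natDegree_eq_of_le_of_coeff_ne_zero hle' (by rw [hc]; exact one_ne_zero), ?_, ?_, ?_⟩
  · obtain ⟨w, hw⟩ := exists_inv d
    set q := Ideal.Quotient.mk (sIdeal d m) with hq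
    have h0 : ∀ r, m < r → q (PowerSeries.coeff r w) = 0 := by
      intro r
      induction r using Nat.strong_induction_on with
      | _ r ih =>
        intro hr
        rcases Nat.lt_or_ge (m + d) r with hrd | hrd
        · have h1 := congrArg (fun s => q (PowerSeries.coeff r s)) hw
          simp only [PowerSeries.coeff_mul, PowerSeries.coeff_one] at h1
          rw [if_neg (by omega), Finset.Nat.sum_antidiagonal_eq_sum_range_succ_mk, map_sum,
            Finset.sum_range_succ, Finset.sum_eq_zero] at h1
          · simpa [aPoly_coeff, aGen_zero] using h1
          · intro k hk
            simp only [Finset.mem_range] at hk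
            rw [map_mul]
            rcases Nat.lt_or_ge m k with hmk | hmk
            · rw [ih k hk hmk, zero_mul]
            · rw [Polynomial.coeff_coe, Polynomial.coeff_eq_zero_of_natDegree_lt, map_zero, mul_zero]
              have := aPoly_natDegree_le d
              omega
        · have h1 : q (schurDet d r) = 0 := by
            rw [hq, Ideal.Quotient.eq_zero_iff_mem]
            exact Ideal.subset_span ⟨r, ⟨by omega, hrd⟩, rfl⟩
          rw [schurDet_eq d w hw r, map_mul, map_pow, map_neg, map_one] at h1
          exact ((isUnit_one.neg.pow r).mul_right_eq_zero).mp h1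
    let W : Polynomial (MvPolynomial (Fin d) ℤ ⧸ sIdeal d m) :=
      PowerSeries.trunc (m + 1) (PowerSeries.map q w)
    have hWc : (W : PowerSeries (MvPolynomial (Fin d) ℤ ⧸ sIdeal d m)) = PowerSeries.map q w := by
      ext k
      rw [Polynomial.coeff_coe, PowerSeries.coeff_trunc]
      split_ifs with hk
      · rfl
      · rw [PowerSeries.coeff_map, h0 k (by omega)]
    have hWd : W.natDegree ≤ m := by
      have := PowerSeries.natDegree_trunc_lt (PowerSeries.map q w) m
      exact Nat.lt_succ_iff.mp this
    have hWa : (aPoly d).map q * W = 1 := by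
      apply Polynomial.coe_injective
      rw [Polynomial.coe_mul, hWc, Polynomial.coe_one, Polynomial.polynomial_map_coe, ← map_mul,
        mul_comm, hw, map_one]
    refine ⟨Polynomial.reflect m W, ?_⟩
    rw [← Polynomial.reflect_map, ← Polynomial.reflect_mul _ _
      (Polynomial.natDegree_map_le.trans (aPoly_natDegree_le d)) hWd, hWa, reflect_one', add_comm d m]
    simp
  · intro S _ _ j g' hg' hd' hdvd
    obtain ⟨f, hf⟩ := exists_hom d m g' hg' hd' (by simpa using hdvd)
    exact ⟨f, RingHom.ext_int _ _, hf⟩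
  · intro S _ _ f1 f2 _ hg
    apply Ideal.Quotient.ringHom_ext
    apply MvPolynomial.ringHom_ext
    · intro r; simp
    · intro i
      have h1 := congrArg (fun q : Polynomial S => q.coeff (d - (i + 1))) hg
      have hi := i.2
      simp only [Polynomial.coeff_map, Polynomial.coeff_reflect] at h1
      rw [Polynomial.revAt_le (by omega), show d - (d - ((i : ℕ) + 1)) = i + 1 by omega,
        aPoly_coeff, aGen_succ] at h1
      exact h1

lemma quot_nontrivial (d m : ℕ) : Nontrivial (MvPolynomial (Fin d) ℤ ⧸ sIdeal d m) := by
  obtain ⟨f, -⟩ := exists_hom d m (S := ℤ) (Polynomial.X ^ d) (Polynomial.monic_X_pow d)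
    (Polynomial.natDegree_X_pow d) (pow_dvd_pow _ (by omega))
  exact f.domain_nontrivial

lemma free_of_pow {R A ι κ : Type} [CommRing R] [IsDomain R]
    [IsPrincipalIdealRing R] [AddCommGroup A] [Module R A] [Fintype ι] [Fintype κ] [Nonempty ι]
    (c : ℕ) (hcard : Fintype.card κ = Fintype.card ι * c) (ψ : (ι → A) ≃ₗ[R] (κ → R)) :
    Module.Free R A ∧ Module.rank R A = (c : Cardinal) := by
  obtain ⟨k0⟩ := ‹Nonempty ι›
  have hfin1 : Module.Finite R (ι → A) :=
    Module.Finite.equiv ψ.symm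
  have hfin : Module.Finite R A :=
    Module.Finite.of_surjective
      (LinearMap.proj (R := R) (φ := fun _ : ι => A) k0)
      (fun x => ⟨fun _ => x, rfl⟩)
  have hfree1 : Module.Free R (ι → A) :=
    Module.Free.of_equiv ψ.symm
  classical
  have hproj : Module.Projective R A :=
    Module.Projective.of_split
      (LinearMap.single R (fun _ : ι => A) k0)
      (LinearMap.proj k0) (by ext x; simp)
  have hfree : Module.Free R A :=
    Module.free_of_finite_type_torsion_free'
  refine ⟨hfree, ?_⟩
  rw [← Module.finrank_eq_rank]
  have h1 := ψ.finrank_eq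
  rw [Module.finrank_pi_fintype, Module.finrank_fintype_fun_eq_card, hcard, Finset.sum_const,
    Finset.card_univ, smul_eq_mul] at h1
  have h2 := Nat.eq_of_mul_eq_mul_left (Fintype.card_pos_iff.mpr ⟨k0⟩) h1
  rw [h2]

/-- The quotient of `ℤ[a_1,…,a_d]` by the ideal generated by the Schur determinants
`d_r` for `m+1 ≤ r ≤ m+d` is a free `ℤ`-module of rank `binom(m+d, d)`. -/
theorem typeA_presentation_free_rank (d m : ℕ) (hd : 1 ≤ d) :
    Module.Free ℤ (MvPolynomial (Fin d) ℤ ⧸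
        Ideal.span (schurDet d '' Set.Icc (m + 1) (m + d))) ∧
    Module.rank ℤ (MvPolynomial (Fin d) ℤ ⧸
        Ideal.span (schurDet d '' Set.Icc (m + 1) (m + d))) =
      ((m + d).choose d : Cardinal) := by
  have := quot_nontrivial d m
  obtain ⟨ι, κ, _, _, _, hcard, φ, -⟩ := IsUnivDiv.coords d _ _ m _
    (Polynomial.monic_X_pow (m + d)) (Polynomial.natDegree_X_pow (m + d)) (schur_univ d m hd)
  exact free_of_pow (R := ℤ) _ hcard φ.toIntLinearEquiv
end

section
/- Fix integers n ≥ 1 and 0 ≤ k ≤ n, and set m = n − k. In the polynomial ring R = ℤ[σ_1,…,σ_{n+k}], with the conventions σ_0 = 1 and σ_p = 0 for p < 0 or p > n+k, let I ⊆ R be the ideal generated by the elements det(σ_{1+j−i})_{1≤i,j≤r} for n−k+1 ≤ r ≤ n+k, together with the elements σ_r² + 2·∑_{i=1}^{n+k−r} (−1)^i σ_{r+i} σ_{r−i} for k+1 ≤ r ≤ n. Then R/I is a free ℤ-module of rank 2^m · binom(n, k). -/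
open MvPolynomial

/-- The element `σ_p` of `R = ℤ[σ_1,…,σ_{n+k}]`, with the conventions `σ_0 = 1`
and `σ_p = 0` for `p < 0` or `p > n+k`. -/
noncomputable def sGen (n k : ℕ) (p : ℤ) : MvPolynomial (Fin (n + k)) ℤ :=
  if h : 1 ≤ p ∧ p ≤ n + k then X ⟨p.toNat - 1, by omega⟩
  else if p = 0 then 1 else 0

/-- The `r × r` Schur determinant `det (σ_{1+j-i})_{1 ≤ i,j ≤ r}`. -/
noncomputable def sSchurDet (n k : ℕ) (r : ℕ) : MvPolynomial (Fin (n + k)) ℤ :=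
  (Matrix.of fun i j : Fin r => sGen n k (1 + (j : ℤ) - (i : ℤ))).det

/-- The quadratic relation `σ_r² + 2·∑_{i=1}^{n+k-r} (−1)^i σ_{r+i} σ_{r−i}`. -/
noncomputable def sQuadRel (n k : ℕ) (r : ℕ) : MvPolynomial (Fin (n + k)) ℤ :=
  sGen n k r ^ 2 +
    2 * ∑ i ∈ Finset.Icc 1 (n + k - r),
      (-1 : MvPolynomial (Fin (n + k)) ℤ) ^ i * sGen n k (r + i) * sGen n k ((r : ℤ) - i)

namespace Polynomial.IGaux

/-- `p` is monic of degree `m` (formulated so that it makes sense over the zero ring). -/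
def MonDeg {K : Type} [CommRing K] (m : ℕ) (p : K[X]) : Prop := p.natDegree ≤ m ∧ p.coeff m = 1

lemma MonDeg.monic {K : Type} [CommRing K] {m : ℕ} {p : K[X]} (h : MonDeg m p) : p.Monic :=
  monic_of_natDegree_le_of_coeff_eq_one m h.1 h.2

lemma MonDeg.natDegree {K : Type} [CommRing K] [Nontrivial K] {m : ℕ} {p : K[X]} (h : MonDeg m p) :
    p.natDegree = m :=
  le_antisymm h.1 (le_natDegree_of_ne_zero (by rw [h.2]; exact one_ne_zero))

lemma MonDeg.map {K D : Type} [CommRing K] [CommRing D] (φ : K →+* D) {m : ℕ} {p : K[X]}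
    (h : MonDeg m p) : MonDeg m (p.map φ) :=
  ⟨natDegree_map_le.trans h.1, by rw [coeff_map, h.2, map_one]⟩

lemma MonDeg.of_nontrivial {K : Type} [CommRing K] {m : ℕ} {p : K[X]}
    (h : Nontrivial K → p.Monic ∧ p.natDegree = m) : MonDeg m p := by
  cases subsingleton_or_nontrivial K with
  | inl _ => exact ⟨by rw [Subsingleton.elim p 0]; simp, Subsingleton.elim _ _⟩
  | inr hC =>
    obtain ⟨h1, h2⟩ := h hC
    exact ⟨h2.le, by rw [← h2]; exact h1⟩

lemma monDeg_mul_X_sub_C {K : Type} [CommRing K] {m : ℕ} {q : K[X]} (a : K) (h : MonDeg m q) :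
    MonDeg (m + 1) ((X - C a) * q) := by
  refine .of_nontrivial fun _ => ⟨(monic_X_sub_C a).mul h.monic, ?_⟩
  rw [(monic_X_sub_C a).natDegree_mul h.monic, natDegree_X_sub_C, h.natDegree, add_comm]

lemma monDeg_of_mul_X_sub_C {K : Type} [CommRing K] {m : ℕ} {q : K[X]} (a : K)
    (h : MonDeg (m + 1) ((X - C a) * q)) : MonDeg m q := by
  refine .of_nontrivial fun _ => ?_
  have hq : q.Monic := (monic_X_sub_C a).of_mul_monic_left h.monic
  refine ⟨hq, ?_⟩
  have := h.natDegree
  rw [(monic_X_sub_C a).natDegree_mul hq, natDegree_X_sub_C] at this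
  omega

/-- The symplectic factorization relation. -/
def Rel {K : Type} [CommRing K] (m k : ℕ) (f E P : K[X]) : Prop :=
  MonDeg m E ∧ MonDeg k P ∧ (-1) ^ m * (E * E.comp (-X) * expand K 2 P) = expand K 2 f

lemma Rel.map {K D : Type} [CommRing K] [CommRing D] (φ : K →+* D) {m k : ℕ} {f E P : K[X]}
    (h : Rel m k f E P) : Rel m k (f.map φ) (E.map φ) (P.map φ) := by
  refine ⟨h.1.map φ, h.2.1.map φ, ?_⟩
  have := congrArg (Polynomial.map φ) h.2.2
  simpa [Polynomial.map_comp, Polynomial.map_expand] using this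

lemma expand_X_sub {K : Type} [CommRing K] (y : K) :
    expand K 2 (X - C (y ^ 2)) = (X - C y) * (X + C y) := by
  simp; ring

/-- Adding/removing a root. -/
lemma rel_succ_iff {K : Type} [CommRing K] {m k : ℕ} {f E P : K[X]} (y : K) :
    Rel (m + 1) k ((X - C (y ^ 2)) * f) ((X - C y) * E) P ↔ Rel m k f E P := by
  unfold Rel
  have key : (-1) ^ (m + 1) * ((X - C y) * E * ((X - C y) * E).comp (-X) * expand K 2 P)
      = expand K 2 (X - C (y ^ 2)) * ((-1) ^ m * (E * E.comp (-X) * expand K 2 P)) := by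
    rw [expand_X_sub]
    simp only [mul_comp, sub_comp, X_comp, C_comp]
    ring
  rw [key, map_mul]
  have hm : (expand K 2 (X - C (y ^ 2))).Monic := (monic_X_sub_C _).expand (by norm_num)
  constructor
  · rintro ⟨h1, h2, h3⟩
    exact ⟨monDeg_of_mul_X_sub_C _ h1, h2, hm.isRegular.left h3⟩
  · rintro ⟨h1, h2, h3⟩
    exact ⟨monDeg_mul_X_sub_C _ h1, h2, by rw [h3]⟩

/-- `(B, E, P)` is the universal ring over `A` with a symplectic factorization of `f`. -/
structure IsUniv (m k : ℕ) {A B : Type} [CommRing A] [CommRing B] (i : A →+* B) (f : A[X])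
    (E P : B[X]) : Prop where
  rel : Rel m k (f.map i) E P
  ex : ∀ (K : Type) [CommRing K] (j : A →+* K) (E' P' : K[X]), Rel m k (f.map j) E' P' →
    ∃ φ : B →+* K, φ.comp i = j ∧ E.map φ = E' ∧ P.map φ = P'
  uniq : ∀ (K : Type) [CommRing K] (φ ψ : B →+* K), φ.comp i = ψ.comp i → E.map φ = E.map ψ →
    P.map φ = P.map ψ → φ = ψ

lemma free_adjoin {A : Type} [CommRing A] [Module.Free ℤ A] [Module.Finite ℤ A] {m : ℕ} {p : A[X]}
    (h : MonDeg m p) : Module.Free ℤ (AdjoinRoot p) ∧ Module.Finite ℤ (AdjoinRoot p) := by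
  have := h.monic.free_adjoinRoot
  have := h.monic.finite_adjoinRoot
  exact ⟨Module.Free.trans (S := A), Module.Finite.trans A _⟩

lemma finrank_adjoin {A : Type} [CommRing A] [Module.Free ℤ A] {m : ℕ} {p : A[X]}
    (h : MonDeg m p) : Module.finrank ℤ (AdjoinRoot p) = m * Module.finrank ℤ A := by
  cases subsingleton_or_nontrivial A with
  | inl _ =>
    have : Subsingleton (AdjoinRoot p) := Module.subsingleton A _
    simp [Module.finrank_zero_of_subsingleton]
  | inr _ =>
    have := h.monic.free_adjoinRoot
    have := h.monic.finite_adjoinRoot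
    rw [← Module.finrank_mul_finrank ℤ A, (AdjoinRoot.powerBasis' h.monic).finrank,
      AdjoinRoot.powerBasis'_dim, h.natDegree, mul_comm]

lemma of_injective {A : Type} [CommRing A] {m : ℕ} {p : A[X]}
    (h : MonDeg (m + 1) p) : Function.Injective (AdjoinRoot.of p) := by
  cases subsingleton_or_nontrivial A with
  | inl _ => exact Function.injective_of_subsingleton _
  | inr _ =>
    rw [injective_iff_map_eq_zero]
    intro a ha
    rw [← AdjoinRoot.mk_C, AdjoinRoot.mk_eq_zero] at ha
    by_contra hne
    refine h.monic.not_dvd_of_natDegree_lt (by simpa using hne) ?_ ha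
    rw [natDegree_C, h.natDegree]; omega

lemma expand_monDeg {A : Type} [CommRing A] {m : ℕ} {p : A[X]} (h : MonDeg m p) :
    MonDeg (2 * m) (expand A 2 p) := by
  refine ⟨?_, ?_⟩
  · rw [natDegree_expand]; have := h.1; omega
  · rw [mul_comm, coeff_expand_mul (by norm_num), h.2]

theorem univ_free (k m : ℕ) : ∀ (A B : Type) [CommRing A] [CommRing B] (i : A →+* B) (f : A[X])
    (E P : B[X]), Module.Free ℤ A → Module.Finite ℤ A → MonDeg (m + k) f → IsUniv m k i f E P →
    Module.Free ℤ B ∧ Module.Finite ℤ B ∧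
      Module.finrank ℤ B = 2 ^ m * (m + k).choose m * Module.finrank ℤ A := by
  induction m with
  | zero =>
    intro A B _ _ i f E P hA hA' hf hU
    have h1 : ∀ (K : Type) [CommRing K] (e p g: K[X]), Rel 0 k g e p → e = 1 ∧ p = g := by
      intro K _ e p g h
      have he : e = 1 := by
        ext j
        rcases Nat.eq_zero_or_pos j with rfl | hj
        · simpa using h.1.2
        · rw [coeff_eq_zero_of_natDegree_lt (h.1.1.trans_lt hj), coeff_one, if_neg hj.ne']
      refine ⟨he, expand_injective (n := 2) (by norm_num) ?_⟩
      simpa [he] using h.2.2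
    obtain ⟨φ, hφ, -, -⟩ := hU.ex A (RingHom.id A) 1 f
      ⟨⟨by simp, by simp⟩, by simpa using hf, by simp⟩
    have h2 : i.comp φ = RingHom.id B := by
      apply hU.uniq
      · rw [RingHom.comp_assoc, hφ]; rfl
      · rw [(h1 _ _ _ _ hU.rel).1]; simp
      · rw [(h1 _ _ _ _ hU.rel).2]
        rw [Polynomial.map_map, RingHom.comp_assoc, hφ]; simp
    let e : A ≃+* B := RingEquiv.ofRingHom i φ h2 hφ
    let e' : A ≃ₗ[ℤ] B := e.toAddEquiv.toIntLinearEquiv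
    refine ⟨Module.Free.of_equiv e', Module.Finite.equiv e', ?_⟩
    rw [← e'.finrank_eq]; simp
  | succ m ih =>
    intro A B _ _ i f E P hA hA' hf hU
    set f2 := expand A 2 f with hf2
    have hf2d : MonDeg (2 * (m + 1 + k)) f2 := expand_monDeg hf
    let B' := AdjoinRoot E
    let A' := AdjoinRoot f2
    let x : A' := AdjoinRoot.root f2
    let y : B' := AdjoinRoot.root E
    have hy : (E.map (AdjoinRoot.of E)).eval y = 0 := by
      rw [eval_map]; exact AdjoinRoot.eval₂_root E
    have hx : (expand A' 2 (f.map (AdjoinRoot.of f2))).eval x = 0 := by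
      rw [← Polynomial.map_expand, eval_map]; exact AdjoinRoot.eval₂_root f2
    have hlift : f2.eval₂ ((AdjoinRoot.of E).comp i) y = 0 := by
      rw [← eval_map, ← Polynomial.map_map, hf2, Polynomial.map_expand, ← hU.rel.2.2]
      simp [Polynomial.map_mul, hy]
    let i' : A' →+* B' := AdjoinRoot.lift ((AdjoinRoot.of E).comp i) y hlift
    have hi'x : i' x = y := AdjoinRoot.lift_root hlift
    have hi'of : i'.comp (AdjoinRoot.of f2) = (AdjoinRoot.of E).comp i :=
      AdjoinRoot.lift_comp_of hlift
    have hdE : X - C y ∣ E.map (AdjoinRoot.of E) := dvd_iff_isRoot.2 hy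
    obtain ⟨E', hE'⟩ := hdE
    have hdf : X - C (x ^ 2) ∣ f.map (AdjoinRoot.of f2) := by
      apply dvd_iff_isRoot.2
      rw [expand_eval] at hx
      exact hx
    obtain ⟨f', hf'⟩ := hdf
    have hf'd : MonDeg (m + k) f' := by
      apply monDeg_of_mul_X_sub_C (x ^ 2)
      rw [← hf', show m + k + 1 = m + 1 + k by ring]
      exact hf.map _
    have hmapf : ∀ (K : Type) [CommRing K] (j : A' →+* K),
        f.map (j.comp (AdjoinRoot.of f2)) = (X - C (j x ^ 2)) * f'.map j := by
      intro K _ j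
      rw [← Polynomial.map_map, hf']; simp
    have hU' : IsUniv m k i' f' E' (P.map (AdjoinRoot.of E)) := by
      refine ⟨?_, ?_, ?_⟩
      · rw [← rel_succ_iff y, ← hE', ← hi'x, ← hmapf, hi'of, ← Polynomial.map_map]
        exact hU.rel.map _
      · intro K _ j e p hep
        rw [← rel_succ_iff (j x), ← hmapf] at hep
        obtain ⟨φ, h1, h2, h3⟩ := hU.ex K _ _ _ hep
        have hφ : E.eval₂ φ (j x) = 0 := by
          rw [← eval_map, h2]; simp
        refine ⟨AdjoinRoot.lift φ (j x) hφ, ?_, ?_, ?_⟩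
        · apply AdjoinRoot.ringHom_ext
          · rw [RingHom.comp_assoc, hi'of, ← RingHom.comp_assoc, AdjoinRoot.lift_comp_of, h1]
          · change AdjoinRoot.lift φ (j x) hφ (i' x) = j x
            rw [hi'x]; exact AdjoinRoot.lift_root hφ
        · have h4 := congrArg (Polynomial.map (AdjoinRoot.lift φ (j x) hφ)) hE'
          rw [Polynomial.map_map, AdjoinRoot.lift_comp_of, h2] at h4
          have h5 : AdjoinRoot.lift φ (j x) hφ y = j x := AdjoinRoot.lift_root hφ
          simp only [Polynomial.map_mul, Polynomial.map_sub, Polynomial.map_X, Polynomial.map_C,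
            h5] at h4
          exact ((monic_X_sub_C _).isRegular.left h4).symm
        · rw [Polynomial.map_map, AdjoinRoot.lift_comp_of, h3]
      · intro K _ φ ψ h1 h2 h3
        have hxy : φ y = ψ y := by
          rw [← hi'x]; exact RingHom.congr_fun h1 x
        apply AdjoinRoot.ringHom_ext
        · apply hU.uniq
          · rw [RingHom.comp_assoc, RingHom.comp_assoc, ← hi'of, ← RingHom.comp_assoc, h1]; rfl
          · rw [← Polynomial.map_map, ← Polynomial.map_map, hE']
            simp [h2, hxy]
          · simpa [Polynomial.map_map] using h3
        · exact hxy
    obtain ⟨hA1, hA2⟩ := free_adjoin hf2d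
    obtain ⟨hB1, hB2, hB3⟩ := ih A' B' i' f' E' _ hA1 hA2 hf'd hU'
    have hinj : Function.Injective (AdjoinRoot.of E) := of_injective hU.rel.1
    let l : B →ₗ[ℤ] B' := (AdjoinRoot.of E).toAddMonoidHom.toIntLinearMap
    have hl : Function.Injective l := hinj
    have hfin : Module.Finite ℤ B := Module.Finite.of_injective l hl
    have htf : Module.IsTorsionFree ℤ B := hl.moduleIsTorsionFree l (fun c x => map_smul l c x)
    have hfree : Module.Free ℤ B := inferInstance
    refine ⟨hfree, hfin, ?_⟩
    have r1 := finrank_adjoin hU.rel.1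
    have r2 := finrank_adjoin hf2d
    have r3 : (m + 1) * Module.finrank ℤ B
        = 2 ^ m * (m + k).choose m * (2 * (m + 1 + k) * Module.finrank ℤ A) := by
      rw [← r1, ← r2]; exact hB3
    have r4 := Nat.add_one_mul_choose_eq (m + k) m
    apply Nat.eq_of_mul_eq_mul_left (Nat.succ_pos m)
    rw [Nat.succ_eq_add_one, r3, show m + 1 + k = m + k + 1 by ring]
    calc _ = 2 ^ (m + 1) * Module.finrank ℤ A * ((m + k + 1) * (m + k).choose m) := by ring
      _ = _ := by rw [r4]; ring

end Polynomial.IGaux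
namespace Polynomial.IGaux

lemma coeff_negX {K : Type} [CommRing K] (p : K[X]) (j : ℕ) :
    (p.comp (-X)).coeff j = (-1) ^ j * p.coeff j := by
  have : (-X : K[X]) = C (-1) * X := by simp
  rw [this, comp_C_mul_X_coeff, mul_comm]

lemma natDegree_negX {K : Type} [CommRing K] {p : K[X]} {m : ℕ} (h : p.natDegree ≤ m) :
    (p.comp (-X)).natDegree ≤ m := by
  rw [natDegree_le_iff_coeff_eq_zero] at h ⊢
  intro j hj
  rw [coeff_negX, h j hj, mul_zero]

/-- The symplectic factorization relation in reversed form. -/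
def RelT {K : Type} [CommRing K] (m k : ℕ) (e p : K[X]) : Prop :=
  e.natDegree ≤ m ∧ e.coeff 0 = 1 ∧ p.natDegree ≤ k ∧ p.coeff 0 = 1 ∧
    e * e.comp (-X) * expand K 2 p = 1

lemma reflect_le {K : Type} [CommRing K] {p : K[X]} {m : ℕ} (h : p.natDegree ≤ m) :
    (reflect m p).natDegree ≤ m := by
  rw [natDegree_le_iff_coeff_eq_zero] at h ⊢
  intro j hj
  rw [coeff_reflect, revAt_eq_self_of_lt hj, h j hj]

lemma reflect_negX {K : Type} [CommRing K] {p : K[X]} {m : ℕ} (h : p.natDegree ≤ m) :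
    reflect m (p.comp (-X)) = (-1) ^ m * (reflect m p).comp (-X) := by
  have h0 : ((-1) ^ m : K[X]) = C ((-1) ^ m) := by simp
  ext j
  rw [h0, coeff_C_mul, coeff_reflect, coeff_negX, coeff_negX, coeff_reflect]
  rcases le_or_gt j m with hj | hj
  · rw [revAt_le hj, ← mul_assoc, ← pow_add]
    congr 1
    obtain ⟨c, rfl⟩ := Nat.exists_eq_add_of_le hj
    rw [show j + c - j = c by omega, show j + c + j = c + 2 * j by ring, pow_add, pow_mul]; simp
  · rw [revAt_eq_self_of_lt hj, coeff_eq_zero_of_natDegree_lt (h.trans_lt hj)]; simp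

lemma reflect_expand {K : Type} [CommRing K] {p : K[X]} {k : ℕ} :
    reflect (2 * k) (expand K 2 p) = expand K 2 (reflect k p) := by
  ext j
  rw [coeff_reflect, coeff_expand two_pos, coeff_expand two_pos, coeff_reflect]
  rcases le_or_gt j (2 * k) with hj | hj
  · rw [revAt_le hj]
    by_cases h2 : 2 ∣ j
    · obtain ⟨c, rfl⟩ := h2
      rw [if_pos (by omega), if_pos (by omega), revAt_le (by omega)]
      congr 1; omega
    · rw [if_neg (by omega), if_neg h2]
  · rw [revAt_eq_self_of_lt hj]
    by_cases h2 : 2 ∣ j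
    · rw [if_pos h2, if_pos h2, revAt_eq_self_of_lt (by omega)]
    · rw [if_neg h2, if_neg h2]

lemma expand_le {K : Type} [CommRing K] {p : K[X]} {k : ℕ} (h : p.natDegree ≤ k) :
    (expand K 2 p).natDegree ≤ 2 * k := by
  rw [natDegree_expand]; omega

lemma reflect_prod {K : Type} [CommRing K] {m k : ℕ} {e p : K[X]} (he : e.natDegree ≤ m)
    (hp : p.natDegree ≤ k) : reflect (m + m + 2 * k) (e * e.comp (-X) * expand K 2 p) =
      (-1) ^ m * (reflect m e * (reflect m e).comp (-X) * expand K 2 (reflect k p)) := by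
  rw [reflect_mul _ _ (natDegree_mul_le_of_le he (natDegree_negX he)) (expand_le hp),
    reflect_mul _ _ he (natDegree_negX he), reflect_negX he, reflect_expand]
  ring

lemma reflect_reflect {K : Type} [CommRing K] (m : ℕ) (p : K[X]) :
    reflect m (reflect m p) = p := by
  ext j; simp

lemma relT_of_rel {K : Type} [CommRing K] {m k : ℕ} {E P : K[X]}
    (h : Rel m k (X ^ (m + k)) E P) : RelT m k (reflect m E) (reflect k P) := by
  obtain ⟨h1, h2, h3⟩ := h
  refine ⟨reflect_le h1.1, ?_, reflect_le h2.1, ?_, ?_⟩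
  · simpa [coeff_reflect] using h1.2
  · simpa [coeff_reflect] using h2.2
  · have h4 := reflect_prod h1.1 h2.1
    have h5 : E * E.comp (-X) * expand K 2 P = (-1) ^ m * X ^ (m + m + 2 * k) := by
      have h6 := congrArg (fun z => (-1) ^ m * z) h3
      simp only [← mul_assoc, ← pow_add, ← two_mul, pow_mul] at h6
      simp only [even_two, Even.neg_pow, one_pow, one_mul] at h6
      rw [h6, map_pow, expand_X, ← pow_mul]; congr 2; ring
    have h0 : ((-1) ^ m : K[X]) = C ((-1) ^ m) := by simp
    rw [h5, h0, reflect_C_mul, reflect_monomial, revAt_le le_rfl, ← h0] at h4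
    have h7 := congrArg (fun z => (-1) ^ m * z) h4
    simp only [← mul_assoc, ← pow_add, ← two_mul, pow_mul] at h7
    simpa using h7.symm

lemma rel_of_relT {K : Type} [CommRing K] {m k : ℕ} {e p : K[X]}
    (h : RelT m k e p) : Rel m k (X ^ (m + k)) (reflect m e) (reflect k p) := by
  obtain ⟨h1, h2, h3, h4, h5⟩ := h
  refine ⟨⟨reflect_le h1, ?_⟩, ⟨reflect_le h3, ?_⟩, ?_⟩
  · simpa [coeff_reflect] using h2
  · simpa [coeff_reflect] using h4
  · rw [← reflect_prod h1 h3, h5, ← C_1, reflect_C, map_pow, expand_X, ← pow_mul]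
    simp; congr 1; ring

lemma map_reflect {K D : Type} [CommRing K] [CommRing D] (φ : K →+* D) (m : ℕ) (p : K[X]) :
    (reflect m p).map φ = reflect m (p.map φ) := by
  ext j; simp [coeff_reflect]

/-- Universality over `ℤ` can be checked in the reversed form. -/
lemma isUniv_of_relT {B : Type} [CommRing B] {m k : ℕ} {e p : B[X]} (h : RelT m k e p)
    (hex : ∀ (K : Type) [CommRing K] (e' p' : K[X]), RelT m k e' p' →
      ∃ φ : B →+* K, e.map φ = e' ∧ p.map φ = p')
    (huniq : ∀ (K : Type) [CommRing K] (φ ψ : B →+* K), e.map φ = e.map ψ → p.map φ = p.map ψ →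
      φ = ψ) :
    IsUniv m k (Int.castRingHom B) (X ^ (m + k)) (reflect m e) (reflect k p) := by
  refine ⟨by simpa using rel_of_relT h, ?_, ?_⟩
  · intro K _ j E P hEP
    rw [Polynomial.map_pow, map_X] at hEP
    obtain ⟨φ, h1, h2⟩ := hex K _ _ (relT_of_rel hEP)
    refine ⟨φ, RingHom.ext_int _ _, ?_, ?_⟩
    · rw [map_reflect, h1, reflect_reflect]
    · rw [map_reflect, h2, reflect_reflect]
  · intro K _ φ ψ _ h1 h2
    apply huniq
    · rw [← reflect_reflect m (e.map φ), ← map_reflect, h1, map_reflect, reflect_reflect]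
    · rw [← reflect_reflect k (p.map φ), ← map_reflect, h2, map_reflect, reflect_reflect]

/-- Toeplitz determinants of a power series are the coefficients of its inverse. -/
lemma det_toeplitz {K : Type} [CommRing K] (s v : PowerSeries K) (hsv : s * v = 1)
    (hs : PowerSeries.coeff 0 s = 1) (σ : ℤ → K) (h1 : ∀ j : ℕ, σ j = PowerSeries.coeff j s)
    (h2 : ∀ j : ℤ, j < 0 → σ j = 0) (r : ℕ) :
    (Matrix.of fun i j : Fin r => σ (1 + (j : ℤ) - (i : ℤ))).det
      = (-1) ^ r * PowerSeries.coeff r v := by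
  let U : Matrix (Fin (r + 1)) (Fin (r + 1)) K := Matrix.of fun i j => σ ((j : ℤ) - i)
  let V : Matrix (Fin (r + 1)) (Fin (r + 1)) K := Matrix.of fun i j =>
    if (i : ℕ) ≤ j then PowerSeries.coeff ((j : ℕ) - i) v else 0
  have hU : U.det = 1 := by
    rw [Matrix.det_of_isUpperTriangular]
    · apply Finset.prod_eq_one
      intro i _
      have := h1 0
      simp only [U, Matrix.of_apply, sub_self]
      rw [← hs, ← this]; rfl
    · intro i j hij
      apply h2
      have : (j : ℕ) < i := hij
      omega
  have hUV : U * V = 1 := by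
    ext i j
    rw [Matrix.mul_apply]
    have hval := Fin.sum_univ_eq_sum_range (fun l : ℕ => σ ((l : ℤ) - i) *
        (if l ≤ j then PowerSeries.coeff ((j : ℕ) - l) v else 0)) (r + 1)
    refine Eq.trans hval ?_
    rcases lt_or_ge (j : ℕ) i with hij | hij
    · rw [Matrix.one_apply_ne (by rintro rfl; omega)]
      apply Finset.sum_eq_zero
      intro l _
      by_cases hl : l ≤ j
      · rw [h2 _ (by omega), zero_mul]
      · rw [if_neg hl, mul_zero]
    · obtain ⟨d, hd⟩ := Nat.exists_eq_add_of_le hij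
      have hsub : ∀ a b : ℕ, b = a + d → b < r + 1 →
          ∑ l ∈ Finset.range (r + 1), σ ((l : ℤ) - a) *
          (if l ≤ b then PowerSeries.coeff (b - l) v else 0) =
          PowerSeries.coeff d (s * v) := by
        intro a b hab hb
        rw [PowerSeries.coeff_mul, Finset.Nat.sum_antidiagonal_eq_sum_range_succ_mk]
        rw [show r + 1 = a + (d + 1 + (r - (a + d))) by omega, Finset.sum_range_add,
          Finset.sum_range_add _ (d + 1)]
        rw [Finset.sum_eq_zero, zero_add]
        · rw [Finset.sum_congr rfl, add_eq_left]
          · apply Finset.sum_eq_zero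
            intro l _
            rw [if_neg (by omega), mul_zero]
          · intro l hl
            rw [Finset.mem_range] at hl
            rw [if_pos (by omega), ← h1]
            congr 2
            · push_cast; ring
            · congr 1; omega
        · intro l hl
          rw [Finset.mem_range] at hl
          rw [h2 _ (by omega), zero_mul]
      rw [hsub i j hd j.2, hsv, PowerSeries.coeff_one, Matrix.one_apply]
      congr 1
      rw [Fin.ext_iff, eq_iff_iff]; omega
  have hadj : U.adjugate = V := by
    calc U.adjugate = U.adjugate * (U * V) := by rw [hUV, mul_one]
      _ = V := by rw [← mul_assoc, Matrix.adjugate_mul, hU, one_smul, one_mul]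
  have h3 := congrFun (congrFun hadj 0) (Fin.last r)
  rw [Matrix.adjugate_fin_succ_eq_det_submatrix] at h3
  have h4 : U.submatrix (Fin.last r).succAbove (Fin.succAbove 0) =
      Matrix.of fun i j : Fin r => σ (1 + (j : ℤ) - (i : ℤ)) := by
    ext i j
    simp only [U, Matrix.submatrix_apply, Matrix.of_apply, Fin.succAbove_last, Fin.succAbove_zero,
      Fin.val_succ, Fin.val_castSucc]
    congr 1; push_cast; ring
  rw [h4] at h3
  simp only [V, Matrix.of_apply, Fin.val_last, Fin.val_zero, zero_le, if_true, Nat.sub_zero,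
    add_zero] at h3
  rw [← h3, ← mul_assoc, ← pow_add, ← two_mul, pow_mul]; simp

/-- The coefficients of `s(t) s(-t)`. -/
lemma coeff_quad {K : Type} [CommRing K] (s : K[X]) (N : ℕ) (hN : s.natDegree ≤ N)
    (σ : ℤ → K) (h1 : ∀ j : ℕ, σ j = s.coeff j)
    (h2 : ∀ j : ℤ, j < 0 → σ j = 0) (r : ℕ) :
    (s * s.comp (-X)).coeff (2 * r) = (-1) ^ r * (σ r ^ 2 + 2 * ∑ i ∈ Finset.Icc 1 (N - r),
      (-1) ^ i * σ (r + i) * σ ((r : ℤ) - i)) := by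
  have hext : ∑ i ∈ Finset.Icc 1 (N - r), (-1) ^ i * σ (r + i) * σ ((r : ℤ) - i) =
      ∑ i ∈ Finset.Icc 1 r, (-1) ^ i * σ (r + i) * σ ((r : ℤ) - i) := by
    have hA : Finset.Icc 1 (N - r) ⊆ Finset.Icc 1 (N + r) :=
      Finset.Icc_subset_Icc_right (by omega)
    have hB : Finset.Icc 1 r ⊆ Finset.Icc 1 (N + r) := Finset.Icc_subset_Icc_right (by omega)
    rw [Finset.sum_subset hA, Finset.sum_subset hB]
    · intro i _ hi
      rw [Finset.mem_Icc] at *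
      rw [h2 ((r : ℤ) - i) (by omega), mul_zero]
    · intro i _ hi
      rw [Finset.mem_Icc] at *
      rw [show (r : ℤ) + i = ((r + i : ℕ) : ℤ) by push_cast; rfl, h1,
        coeff_eq_zero_of_natDegree_lt (by omega)]
      simp
  rw [hext, coeff_mul, Finset.Nat.sum_antidiagonal_eq_sum_range_succ_mk]
  simp only [coeff_negX]
  rw [show (2 * r).succ = r + (1 + r) by omega, Finset.sum_range_add, Finset.sum_range_add _ 1,
    ← Finset.sum_range_reflect]
  have hIcc : ∀ g : ℕ → K, ∑ i ∈ Finset.Icc 1 r, g i = ∑ i ∈ Finset.range r, g (1 + i) := by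
    intro g
    rw [← Finset.Ico_add_one_right_eq_Icc, Finset.sum_Ico_eq_sum_range]
    simp
  rw [hIcc]
  have e1 : ∀ i ∈ Finset.range r, s.coeff (r - 1 - i) * ((-1) ^ (2 * r - (r - 1 - i)) *
      s.coeff (2 * r - (r - 1 - i))) = (-1) ^ r * ((-1) ^ (1 + i) * σ (r + (1 + i : ℕ)) *
        σ ((r : ℤ) - (1 + i : ℕ))) := by
    intro i hi
    rw [Finset.mem_range] at hi
    rw [show (r : ℤ) + (1 + i : ℕ) = ((r + (1 + i) : ℕ) : ℤ) by push_cast; rfl,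
      show (r : ℤ) - (1 + i : ℕ) = ((r - 1 - i : ℕ) : ℤ) by omega, h1, h1,
      show 2 * r - (r - 1 - i) = r + (1 + i) by omega, pow_add]
    ring
  have e2 : ∀ i ∈ Finset.range r, s.coeff (r + (1 + i)) * ((-1) ^ (2 * r - (r + (1 + i))) *
      s.coeff (2 * r - (r + (1 + i)))) = (-1) ^ r * ((-1) ^ (1 + i) * σ (r + (1 + i : ℕ)) *
        σ ((r : ℤ) - (1 + i : ℕ))) := by
    intro i hi
    rw [Finset.mem_range] at hi
    rw [show (r : ℤ) + (1 + i : ℕ) = ((r + (1 + i) : ℕ) : ℤ) by push_cast; rfl,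
      show (r : ℤ) - (1 + i : ℕ) = ((r - 1 - i : ℕ) : ℤ) by omega, h1, h1,
      show 2 * r - (r + (1 + i)) = r - 1 - i by omega]
    have : ((-1) ^ (r - 1 - i) : K) = (-1) ^ r * (-1) ^ (1 + i) := by
      rw [← pow_add, show r + (1 + i) = (r - 1 - i) + 2 * (1 + i) by omega, pow_add, pow_mul]
      simp
    rw [this]; ring
  rw [Finset.sum_congr rfl e1, Finset.sum_congr rfl e2, ← Finset.mul_sum]
  simp only [Finset.sum_range_one, add_zero]
  rw [show 2 * r - r = r by omega, h1]
  ring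

lemma dvd_of_dvd_mul {K : Type} [CommRing K] {p g : K[X]} (hp : p.coeff 0 = 1) {a : ℕ}
    (h : X ^ a ∣ p * g) : X ^ a ∣ g := by
  have h1 : IsCoprime (X : K[X]) p := ⟨-p.divX, 1, by
    have := divX_mul_X_add p
    rw [hp] at this
    nth_rw 2 [← this]; simp⟩
  exact (h1.pow_left (m := a)).dvd_of_dvd_mul_left h

lemma eq_zero_of_dvd {K : Type} [CommRing K] {g : K[X]} {a : ℕ} (h : X ^ (a + 1) ∣ g)
    (hd : g.natDegree ≤ a) : g = 0 := by
  rw [X_pow_dvd_iff] at h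
  ext j
  rcases le_or_gt j a with hj | hj
  · rw [h j (by omega), coeff_zero]
  · rw [coeff_eq_zero_of_natDegree_lt (hd.trans_lt hj), coeff_zero]

lemma negX_negX {K : Type} [CommRing K] (p : K[X]) : (p.comp (-X)).comp (-X) = p := by
  rw [comp_assoc]; simp

lemma expand_negX {K : Type} [CommRing K] (p : K[X]) :
    (expand K 2 p).comp (-X) = expand K 2 p := by
  ext j
  rw [coeff_negX, coeff_expand two_pos]
  split_ifs with h
  · obtain ⟨c, rfl⟩ := h
    simp [pow_mul]
  · simp

lemma coeff_odd {K : Type} [CommRing K] (s : K[X]) {d : ℕ} (hd : ¬ 2 ∣ d) :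
    (s * s.comp (-X)).coeff d = 0 := by
  rw [coeff_mul]
  refine Finset.sum_involution (fun x _ => x.swap) ?_ ?_ ?_ ?_
  · rintro ⟨a, b⟩ hab
    rw [Finset.HasAntidiagonal.mem_antidiagonal] at hab
    simp only [coeff_negX, Prod.swap] at *
    have : ((-1) ^ a : K) = - (-1) ^ b := by
      rcases Nat.even_or_odd a with ha | ha
      · have hb : Odd b := by
          rw [Nat.odd_iff]; rw [Nat.even_iff] at ha; omega
        rw [ha.neg_one_pow, hb.neg_one_pow]; simp
      · have hb : Even b := by
          rw [Nat.even_iff]; rw [Nat.odd_iff] at ha; omega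
        rw [ha.neg_one_pow, hb.neg_one_pow]
    rw [this]; ring
  · rintro ⟨a, b⟩ hab _ h
    rw [Finset.HasAntidiagonal.mem_antidiagonal] at hab
    simp only [Prod.swap, Prod.mk.injEq] at *
    omega
  · rintro ⟨a, b⟩ hab
    rw [Finset.HasAntidiagonal.mem_antidiagonal] at *
    simp only [Prod.swap] at *
    omega
  · rintro ⟨a, b⟩ _
    rfl

/-- The key argument: the relations of the presentation force the factorization. -/
lemma key_relT {K : Type} [CommRing K] {n k m : ℕ} (hm : m + k = n) {s w : K[X]}
    (hs : s.natDegree ≤ n + k) (hw : w.natDegree ≤ m) (hs0 : s.coeff 0 = 1) (hw0 : w.coeff 0 = 1)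
    (hsw : ∀ j, 1 ≤ j → j ≤ n + k → (s * w).coeff j = 0)
    (hq : ∀ r, k + 1 ≤ r → r ≤ n → (s * s.comp (-X)).coeff (2 * r) = 0) :
    ∃ p, RelT m k (w.comp (-X)) p ∧ s = expand K 2 p * w.comp (-X) := by
  set e := w.comp (-X) with he
  have hew : e.comp (-X) = w := negX_negX w
  have hed : e.natDegree ≤ m := natDegree_negX hw
  set q := s * s.comp (-X) with hqdef
  have hqn : q.comp (-X) = q := by
    rw [hqdef, mul_comp, negX_negX, mul_comm]
  let p : K[X] := ∑ i ∈ Finset.range (k + 1), monomial i (q.coeff (2 * i))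
  have hpc : ∀ j, p.coeff j = if j < k + 1 then q.coeff (2 * j) else 0 := by
    intro j
    simp [p, coeff_monomial]
  have hpd : p.natDegree ≤ k := by
    rw [natDegree_le_iff_coeff_eq_zero]
    intro j hj
    rw [hpc, if_neg (by omega)]
  have hp0 : p.coeff 0 = 1 := by
    rw [hpc, if_pos (by omega), hqdef, mul_zero, mul_coeff_zero, coeff_negX, hs0]; simp
  have hsw1 : X ^ (n + k + 1) ∣ s * w - 1 := by
    rw [X_pow_dvd_iff]
    intro d hd
    rcases Nat.eq_zero_or_pos d with rfl | hd0
    · simp [mul_coeff_zero, hs0, hw0]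
    · rw [coeff_sub, hsw d hd0 (by omega), coeff_one, if_neg hd0.ne']; simp
  have hse1 : X ^ (n + k + 1) ∣ s.comp (-X) * e - 1 := by
    rw [X_pow_dvd_iff] at hsw1 ⊢
    intro d hd
    have : s.comp (-X) * e - 1 = (s * w - 1).comp (-X) := by simp [he]
    rw [this, coeff_negX, hsw1 d hd, mul_zero]
  have hqp : X ^ (2 * n + 1 + 1) ∣ q - expand K 2 p := by
    rw [X_pow_dvd_iff]
    intro d hd
    rw [coeff_sub, coeff_expand two_pos]
    by_cases h2 : 2 ∣ d
    · obtain ⟨c, rfl⟩ := h2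
      rw [if_pos (by omega), Nat.mul_div_cancel_left _ two_pos, hpc]
      split_ifs with hc
      · rw [sub_self]
      · rw [hq c (by omega) (by omega), sub_zero]
    · rw [if_neg h2, coeff_odd s h2, sub_zero]
  have hsp : s = expand K 2 p * e := by
    rw [← sub_eq_zero]
    apply eq_zero_of_dvd (a := n + k)
    · have h1 : X ^ (n + k + 1) ∣ (q - expand K 2 p) * e :=
        ((pow_dvd_pow _ (by omega)).trans hqp).mul_right _
      have h2 := hse1.mul_left s
      have h3 : s - expand K 2 p * e
          = (q - expand K 2 p) * e - s * (s.comp (-X) * e - 1) := by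
        rw [hqdef]; ring
      rw [h3]
      exact dvd_sub h1 h2
    · refine natDegree_sub_le_of_le hs ?_ |>.trans (le_of_eq (max_self _))
      exact (natDegree_mul_le_of_le (expand_le hpd) hed).trans (by omega)
  have hsn : s.comp (-X) = expand K 2 p * w := by
    rw [hsp, mul_comp, expand_negX, hew]
  have hsw2 : s * w = 1 := by
    rw [← sub_eq_zero]
    apply eq_zero_of_dvd (a := 2 * n + 1)
    · apply dvd_of_dvd_mul (p := expand K 2 p)
      · rw [coeff_expand two_pos]; simpa using hp0
      · have h3 : expand K 2 p * (s * w - 1) = q - expand K 2 p := by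
          rw [hqdef, hsn]; ring
        rw [h3]; exact hqp
    · refine (natDegree_sub_le_of_le (natDegree_mul_le_of_le hs hw)
        (n := 0) (by simp)).trans ?_
      simp; omega
  refine ⟨p, ⟨hed, ?_, hpd, hp0, ?_⟩, hsp⟩
  · rw [he, coeff_negX, hw0]; simp
  · rw [hew, ← hsw2]
    conv_rhs => rw [hsp]
    ring

end Polynomial.IGaux
namespace Polynomial.IGaux

lemma sign_flip {K : Type} [CommRing K] {a b : K} {r : ℕ} (h : a = (-1) ^ r * b) :
    b = (-1) ^ r * a := by
  rw [h, ← mul_assoc, ← pow_add, Even.neg_one_pow ⟨r, rfl⟩, one_mul]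

lemma sGen_neg (n k : ℕ) (p : ℤ) (hp : p < 0) : sGen n k p = 0 := by
  unfold sGen
  rw [dif_neg (by omega), if_neg (by omega)]

lemma sGen_zero (n k : ℕ) : sGen n k 0 = 1 := by
  unfold sGen
  rw [dif_neg (by omega), if_pos rfl]

lemma sGen_gt (n k : ℕ) (p : ℤ) (hp : (n + k : ℤ) < p) : sGen n k p = 0 := by
  unfold sGen
  rw [dif_neg (by omega), if_neg (by omega)]

lemma sGen_succ (n k : ℕ) (i : Fin (n + k)) : sGen n k ((i : ℕ) + 1 : ℕ) = MvPolynomial.X i := by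
  unfold sGen
  have := i.2
  rw [dif_pos (by omega)]
  congr 1

/-- The polynomial `∑ ψ(σ_j) t^j`. -/
noncomputable def sPoly (n k : ℕ) {K : Type} [CommRing K]
    (ψ : MvPolynomial (Fin (n + k)) ℤ →+* K) : K[X] :=
  ∑ j ∈ Finset.range (n + k + 1), monomial j (ψ (sGen n k j))

lemma sPoly_coeff (n k : ℕ) {K : Type} [CommRing K]
    (ψ : MvPolynomial (Fin (n + k)) ℤ →+* K) (j : ℕ) :
    (sPoly n k ψ).coeff j = ψ (sGen n k j) := by
  simp only [sPoly, finsetSum_coeff, coeff_monomial, Finset.sum_ite_eq', Finset.mem_range]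
  split_ifs with h
  · rfl
  · rw [sGen_gt _ _ _ (by omega), map_zero]

lemma sPoly_natDegree (n k : ℕ) {K : Type} [CommRing K]
    (ψ : MvPolynomial (Fin (n + k)) ℤ →+* K) : (sPoly n k ψ).natDegree ≤ n + k := by
  rw [natDegree_le_iff_coeff_eq_zero]
  intro j hj
  rw [sPoly_coeff, sGen_gt _ _ _ (by omega), map_zero]

lemma sPoly_zero (n k : ℕ) {K : Type} [CommRing K]
    (ψ : MvPolynomial (Fin (n + k)) ℤ →+* K) : (sPoly n k ψ).coeff 0 = 1 := by
  rw [sPoly_coeff]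
  exact (congrArg ψ (sGen_zero n k)).trans (map_one ψ)

lemma map_schur (n k : ℕ) {K : Type} [CommRing K]
    (ψ : MvPolynomial (Fin (n + k)) ℤ →+* K) (v : PowerSeries K)
    (hv : (sPoly n k ψ : PowerSeries K) * v = 1) (r : ℕ) :
    ψ (sSchurDet n k r) = (-1) ^ r * PowerSeries.coeff r v := by
  rw [← det_toeplitz (sPoly n k ψ : PowerSeries K) v hv (by rw [coeff_coe, sPoly_zero])
    (fun j => ψ (sGen n k j)) (fun j => by rw [coeff_coe, sPoly_coeff])
    (fun j hj => by rw [sGen_neg _ _ _ hj, map_zero]), sSchurDet, RingHom.map_det]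
  rfl

lemma map_quad (n k : ℕ) {K : Type} [CommRing K]
    (ψ : MvPolynomial (Fin (n + k)) ℤ →+* K) (r : ℕ) :
    (sPoly n k ψ * (sPoly n k ψ).comp (-X)).coeff (2 * r) = (-1) ^ r * ψ (sQuadRel n k r) := by
  rw [coeff_quad (sPoly n k ψ) (n + k) (sPoly_natDegree n k ψ)
    (fun j => ψ (sGen n k j)) (fun j => by rw [sPoly_coeff])
    (fun j hj => by rw [sGen_neg _ _ _ hj, map_zero]), sQuadRel]
  have h2 : ψ 2 = 2 := map_ofNat ψ 2
  simp [h2]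

/-- The ideal of relations. -/
noncomputable abbrev relIdeal (n k : ℕ) : Ideal (MvPolynomial (Fin (n + k)) ℤ) :=
  Ideal.span (sSchurDet n k '' Set.Icc (n - k + 1) (n + k) ∪ sQuadRel n k '' Set.Icc (k + 1) n)

lemma exists_univ (m k : ℕ) : ∃ E P : (MvPolynomial (Fin ((m + k) + k)) ℤ ⧸ relIdeal (m + k) k)[X],
    IsUniv m k (Int.castRingHom (MvPolynomial (Fin ((m + k) + k)) ℤ ⧸ relIdeal (m + k) k))
      (X ^ (m + k)) E P := by
  set n := m + k with hn
  let mk : MvPolynomial (Fin (n + k)) ℤ →+* MvPolynomial (Fin (n + k)) ℤ ⧸ relIdeal n k :=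
    Ideal.Quotient.mk (relIdeal n k)
  have hS : ∀ r, m + 1 ≤ r → r ≤ n + k → mk (sSchurDet n k r) = 0 := by
    intro r h1 h2
    apply Ideal.Quotient.eq_zero_iff_mem.2
    apply Ideal.subset_span
    exact Or.inl ⟨r, ⟨by omega, h2⟩, rfl⟩
  have hQ : ∀ r, k + 1 ≤ r → r ≤ n → mk (sQuadRel n k r) = 0 := by
    intro r h1 h2
    apply Ideal.Quotient.eq_zero_iff_mem.2
    apply Ideal.subset_span
    exact Or.inr ⟨r, ⟨h1, h2⟩, rfl⟩
  set s := sPoly n k mk with hs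
  obtain ⟨v, hv⟩ : ∃ v : PowerSeries (MvPolynomial (Fin (n + k)) ℤ ⧸ relIdeal n k),
      (s : PowerSeries _) * v = 1 :=
    ⟨PowerSeries.invOfUnit s 1, PowerSeries.mul_invOfUnit _ _ (by
      rw [← PowerSeries.coeff_zero_eq_constantCoeff_apply, coeff_coe, sPoly_zero]; rfl)⟩
  have hSv := map_schur n k mk v hv
  have hSv' : ∀ r, PowerSeries.coeff r v = (-1) ^ r * mk (sSchurDet n k r) := by
    intro r
    exact sign_flip (hSv r)
  have hv0 : PowerSeries.coeff 0 v = 1 := by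
    rw [hSv', sSchurDet]; simp
  set w := PowerSeries.trunc (m + 1) v with hw
  have hwc : ∀ j, w.coeff j = if j < m + 1 then PowerSeries.coeff j v else 0 :=
    fun j => PowerSeries.coeff_trunc _ _ _
  obtain ⟨p, hp, hsp⟩ := key_relT (n := n) (k := k) (m := m) hn.symm (s := s) (w := w)
    (sPoly_natDegree n k mk)
    (by
      rw [natDegree_le_iff_coeff_eq_zero]
      intro j hj
      rw [hwc, if_neg (by omega)])
    (sPoly_zero n k mk) (by rw [hwc, if_pos (by omega), hv0])
    (by
      intro j hj1 hj2
      have h1 : PowerSeries.coeff j ((s : PowerSeries _) * v) = 0 := by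
        rw [hv, PowerSeries.coeff_one, if_neg (by omega)]
      rw [PowerSeries.coeff_mul] at h1
      rw [coeff_mul, ← h1]
      apply Finset.sum_congr rfl
      rintro ⟨a, b⟩ hab
      rw [Finset.HasAntidiagonal.mem_antidiagonal] at hab
      simp only at hab ⊢
      rw [coeff_coe, hwc]
      split_ifs with hb
      · rfl
      · rw [hSv', hS b (by omega) (by omega), mul_zero, mul_zero, mul_zero])
    (by
      intro r h1 h2
      rw [hs, map_quad, hQ r h1 h2, mul_zero])
  set e := w.comp (-X) with he
  have hec : ∀ j, e.coeff j = if j < m + 1 then mk (sSchurDet n k j) else 0 := by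
    intro j
    rw [he, coeff_negX, hwc]
    split_ifs
    · rw [hSv]
    · rw [mul_zero]
  refine ⟨reflect m e, reflect k p, isUniv_of_relT hp ?_ ?_⟩
  · intro K _ e' p' hep
    obtain ⟨h1, h2, h3, h4, h5⟩ := hep
    set s' := expand K 2 p' * e' with hs'
    have hs'd : s'.natDegree ≤ n + k :=
      (natDegree_mul_le_of_le (expand_le h3) h1).trans (by omega)
    have hs'0 : s'.coeff 0 = 1 := by
      rw [hs', mul_coeff_zero, h2, coeff_expand two_pos]; simpa using h4
    let ψ : MvPolynomial (Fin (n + k)) ℤ →+* K :=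
      MvPolynomial.eval₂Hom (Int.castRingHom K) (fun i => s'.coeff ((i : ℕ) + 1))
    have hψ : sPoly n k ψ = s' := by
      ext j
      rw [sPoly_coeff]
      rcases Nat.eq_zero_or_pos j with rfl | hj
      · rw [hs'0]
        exact (congrArg ψ (sGen_zero n k)).trans (map_one ψ)
      · rcases le_or_gt j (n + k) with hj2 | hj2
        · obtain ⟨i, rfl⟩ : ∃ i, j = i + 1 := ⟨j - 1, by omega⟩
          have := sGen_succ n k ⟨i, by omega⟩
          simp only at this
          rw [this]
          simp [ψ]
        · rw [sGen_gt _ _ _ (by omega), map_zero,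
            coeff_eq_zero_of_natDegree_lt (hs'd.trans_lt hj2)]
    have hs'e : s' * e'.comp (-X) = 1 := by rw [hs', ← h5]; ring
    have hSψ : ∀ r, ψ (sSchurDet n k r) = e'.coeff r := by
      intro r
      rw [map_schur n k ψ (e'.comp (-X) : K[X]) (by
        rw [hψ, ← coe_mul, hs'e, coe_one]), coeff_coe, coeff_negX, ← mul_assoc, ← pow_add,
        ← two_mul, pow_mul]
      simp
    have hQψ : ∀ r, k + 1 ≤ r → ψ (sQuadRel n k r) = 0 := by
      intro r hr
      have h6 := map_quad n k ψ r
      have h7 : s' * s'.comp (-X) = expand K 2 p' := by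
        have : s'.comp (-X) = expand K 2 p' * e'.comp (-X) := by
          rw [hs', mul_comp, expand_negX]
        rw [this, mul_left_comm, hs'e, mul_one]
      rw [hψ, h7, mul_comm 2 r, coeff_expand_mul two_pos,
        coeff_eq_zero_of_natDegree_lt (by omega)] at h6
      have h8 := congrArg (fun z => (-1) ^ r * z) h6
      simp only [← mul_assoc, ← pow_add, ← two_mul, pow_mul] at h8
      simpa using h8.symm
    have hI : ∀ a ∈ relIdeal n k, ψ a = 0 := by
      intro a ha
      have : relIdeal n k ≤ RingHom.ker ψ := by
        rw [Ideal.span_le]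
        rintro _ (⟨r, ⟨hr1, hr2⟩, rfl⟩ | ⟨r, ⟨hr1, hr2⟩, rfl⟩)
        · change ψ _ = 0
          rw [hSψ, coeff_eq_zero_of_natDegree_lt (by omega)]
        · exact hQψ r hr1
      exact this ha
    let φ : (MvPolynomial (Fin (n + k)) ℤ ⧸ relIdeal n k) →+* K :=
      Ideal.Quotient.lift (relIdeal n k) ψ hI
    have hφ : ∀ a, φ (mk a) = ψ a := fun a => Ideal.Quotient.lift_mk _ _ _
    have hφe : e.map φ = e' := by
      ext j
      rw [coeff_map, hec]
      split_ifs with hj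
      · rw [hφ, hSψ]
      · rw [map_zero, coeff_eq_zero_of_natDegree_lt (by omega)]
    refine ⟨φ, hφe, ?_⟩
    apply expand_injective (n := 2) two_pos
    have h6 := congrArg (Polynomial.map φ) hp.2.2.2.2
    simp only [Polynomial.map_mul, Polynomial.map_comp, Polynomial.map_expand, hφe,
      Polynomial.map_neg, map_X, Polynomial.map_one] at h6
    calc expand K 2 (p.map φ)
        = (e' * e'.comp (-X) * expand K 2 p') * expand K 2 (p.map φ) := by rw [h5, one_mul]
      _ = (e' * e'.comp (-X) * expand K 2 (p.map φ)) * expand K 2 p' := by ring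
      _ = expand K 2 p' := by rw [h6, one_mul]
  · intro K _ φ ψ h1 h2
    have hss : s.map φ = s.map ψ := by
      rw [hsp, Polynomial.map_mul, Polynomial.map_mul, Polynomial.map_expand,
        Polynomial.map_expand, h1, h2]
    apply Ideal.Quotient.ringHom_ext
    apply MvPolynomial.ringHom_ext
    · intro a
      simp
    · intro i
      have h3 := congrArg (fun z => z.coeff ((i : ℕ) + 1)) hss
      simp only [coeff_map, hs, sPoly_coeff, sGen_succ] at h3
      exact h3

end Polynomial.IGaux

/-- **Presentation of `H^*(IG(n−k,2n);ℤ)`.**  The quotient of `ℤ[σ_1,…,σ_{n+k}]` by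
the ideal generated by the Schur determinants `det(σ_{1+j-i})` for `n−k+1 ≤ r ≤ n+k`
and the quadratic relations for `k+1 ≤ r ≤ n` is a free `ℤ`-module of rank
`2^m · binom(n,k)`, where `m = n − k`. -/
theorem IG_presentation_free_rank (n k : ℕ) (hn : 1 ≤ n) (hk : k ≤ n) :
    Module.Free ℤ (MvPolynomial (Fin (n + k)) ℤ ⧸
        Ideal.span (sSchurDet n k '' Set.Icc (n - k + 1) (n + k) ∪
          sQuadRel n k '' Set.Icc (k + 1) n)) ∧
    Module.rank ℤ (MvPolynomial (Fin (n + k)) ℤ ⧸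
        Ideal.span (sSchurDet n k '' Set.Icc (n - k + 1) (n + k) ∪
          sQuadRel n k '' Set.Icc (k + 1) n)) =
      (2 ^ (n - k) * n.choose k : Cardinal) := by
  obtain ⟨m, rfl⟩ : ∃ m, n = m + k := ⟨n - k, by omega⟩
  obtain ⟨E, P, hU⟩ := Polynomial.IGaux.exists_univ m k
  obtain ⟨h1, h2, h3⟩ := Polynomial.IGaux.univ_free k m ℤ _ _ _ E P inferInstance inferInstance
    ⟨Polynomial.natDegree_X_pow_le _, by simp⟩ hU
  rw [Module.finrank_self, mul_one, Nat.choose_symm_add] at h3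
  refine ⟨h1, ?_⟩
  have h4 := Module.finrank_eq_rank ℤ
    (MvPolynomial (Fin ((m + k) + k)) ℤ ⧸ Polynomial.IGaux.relIdeal (m + k) k)
  rw [h3] at h4
  refine h4.symm.trans ?_
  rw [Nat.add_sub_cancel]
  push_cast
  rfl
end
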